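/- arXiv:1604.03997 — 3 statements merged into one kernel-verified Lean document; each statement's English description precedes it below -/
import Mathlib

section
/- If Γ ⊂ ℝⁿ is a Meyer, weakly almost periodic set, then the frequency function ρ_Γ admits a mean, and M(ρ_Γ) = D(Γ): for every ε > 0 there is R₀ > 0 such that for all R ≥ R₀ and all x ∈ ℝⁿ, |(1/Vol(B(x,R)))·∑_{v ∈ B(x,R)} ρ_Γ(v) − D(Γ)| < ε. -/
open Filter MeasureTheory Metric Pointwise

variable {E : Type*} [NormedAddCommGroup E] [MeasureSpace E]

/-- The uniform `R`-density of a set. -/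
noncomputable def densR (Γ : Set E) (R : ℝ) : ℝ :=
  ⨆ x : E, ((Γ ∩ ball x R).ncard : ℝ) / (volume (ball x R)).toReal

/-- The uniform upper density of a set. -/
noncomputable def upDens (Γ : Set E) : ℝ := limsup (densR Γ) atTop

/-- Uniformly discrete: balls of radius `r` contain at most one point. -/
def UnifDisc (Γ : Set E) : Prop := ∃ r > 0, ∀ x : E, (Γ ∩ closedBall x r).Subsingleton

/-- Relatively dense: balls of radius `R` contain at least one point. -/
def RelDense (Γ : Set E) : Prop := ∃ R > 0, ∀ x : E, (Γ ∩ closedBall x R).Nonempty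

def Delone (Γ : Set E) : Prop := UnifDisc Γ ∧ RelDense Γ

def Meyer (Γ : Set E) : Prop := Delone Γ ∧ Delone (Γ - Γ)

/-- Frequency of the difference `v` in `Γ`. -/
noncomputable def freq (Γ : Set E) (v : E) : ℝ :=
  upDens {x ∈ Γ | x + v ∈ Γ} / upDens Γ

/-- Weakly almost periodic set. -/
def WAP (Γ : Set E) : Prop :=
  Delone Γ ∧ ∀ ε > 0, ∃ R > 0, ∀ x y : E, ∃ v : E,
    ((symmDiff (Γ ∩ ball x R) ((fun z => z - v) '' (Γ ∩ ball y R))).ncard : ℝ)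
      ≤ ε * (volume (ball (0 : E) R)).toReal

/-- Euclidean space. -/
abbrev EV (n : ℕ) := EuclideanSpace ℝ (Fin n)

/-- Number of points in a ball. -/
noncomputable def cnt {n : ℕ} (Γ : Set (EV n)) (x : EV n) (R : ℝ) : ℝ := ((Γ ∩ ball x R).ncard : ℝ)

/-- Volume of a ball. -/
noncomputable def bv (n : ℕ) (R : ℝ) : ℝ := (volume (ball (0 : EV n) R)).toReal

lemma bv_eq {n : ℕ} (x : EV n) (R : ℝ) : (volume (ball x R)).toReal = bv n R := by
  unfold bv
  rw [Measure.addHaar_ball_center]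

lemma bv_formula (n : ℕ) {R : ℝ} (hR : 0 < R) : bv n R = R ^ n * bv n 1 := by
  unfold bv
  rw [Measure.addHaar_ball_of_pos _ _ hR, ENNReal.toReal_mul, ENNReal.toReal_ofReal (by positivity)]
  simp

lemma bv_pos (n : ℕ) {R : ℝ} (hR : 0 < R) : 0 < bv n R :=
  ENNReal.toReal_pos (measure_ball_pos volume _ hR).ne' measure_ball_lt_top.ne

lemma bv_nonneg (n : ℕ) (R : ℝ) : 0 ≤ bv n R := ENNReal.toReal_nonneg

lemma bv_mono (n : ℕ) {R S : ℝ} (h : R ≤ S) : bv n R ≤ bv n S :=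
  ENNReal.toReal_mono measure_ball_lt_top.ne (measure_mono (ball_subset_ball h))

lemma bv_ratio (n : ℕ) (a : ℝ) : Tendsto (fun S => bv n (S + a) / bv n S) atTop (nhds 1) := by
  have h1 : Tendsto (fun S : ℝ => (1 + a / S) ^ n) atTop (nhds 1) := by
    have := ((tendsto_const_nhds (x := a)).div_atTop tendsto_id).const_add (1 : ℝ)
    simpa using this.pow n
  refine h1.congr' ?_
  filter_upwards [eventually_gt_atTop 0, eventually_gt_atTop (-a)] with S hS hS'
  rw [bv_formula n hS, bv_formula n (by linarith : 0 < S + a)]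
  have := bv_pos n one_pos
  rw [mul_div_mul_right _ _ this.ne', ← div_pow]
  congr 1
  field_simp

lemma UnifDisc.finite_ball {n : ℕ} {Γ : Set (EV n)} (h : UnifDisc Γ) (x : EV n) (R : ℝ) :
    (Γ ∩ ball x R).Finite := by
  obtain ⟨r, hr, h⟩ := h
  have hc : TotallyBounded (ball x R) :=
    (isCompact_closedBall x R).totallyBounded.subset ball_subset_closedBall
  obtain ⟨t, ht, hsub⟩ := Metric.totallyBounded_iff.1 hc r hr
  refine Set.Finite.subset (ht.biUnion (t := fun y => Γ ∩ closedBall y r) fun y _ => (h y).finite) ?_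
  rintro z ⟨hz, hz'⟩
  obtain ⟨y, hy, hzy⟩ := Set.mem_iUnion₂.1 (hsub hz')
  exact Set.mem_iUnion₂.2 ⟨y, hy, hz, ball_subset_closedBall hzy⟩

lemma UnifDisc.mono {n : ℕ} {Γ Λ : Set (EV n)} (h : UnifDisc Γ) (hs : Λ ⊆ Γ) : UnifDisc Λ := by
  obtain ⟨r, hr, h⟩ := h
  exact ⟨r, hr, fun x => (h x).anti (Set.inter_subset_inter_left _ hs)⟩

lemma cnt_mono {n : ℕ} {Γ : Set (EV n)} (h : UnifDisc Γ) (x : EV n) {R S : ℝ} (hRS : R ≤ S) :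
    cnt Γ x R ≤ cnt Γ x S := by
  unfold cnt
  exact_mod_cast Set.ncard_le_ncard (Set.inter_subset_inter_right _ (ball_subset_ball hRS))
    (h.finite_ball x S)

/-- Averaging identity. -/
lemma integral_cnt {n : ℕ} {Γ : Set (EV n)} (h : UnifDisc Γ) (x : EV n) (R S : ℝ) :
    IntegrableOn (fun y => cnt Γ y R) (ball x S) ∧
    ∫ y in ball x S, cnt Γ y R =
      ∑ z ∈ (h.finite_ball x (S + R)).toFinset, (volume (ball z R ∩ ball x S)).toReal := by
  classical
  set F := (h.finite_ball x (S + R)).toFinset with hF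
  have key : Set.EqOn (fun y => cnt Γ y R)
      (fun y => ∑ z ∈ F, (ball z R).indicator (fun _ => (1 : ℝ)) y) (ball x S) := by
    intro y hy
    have : Γ ∩ ball y R = ((F.filter (fun z => y ∈ ball z R) : Finset (EV n)) : Set (EV n)) := by
      ext z
      simp only [hF, Finset.coe_filter, Set.Finite.mem_toFinset, Set.mem_inter_iff, mem_ball,
        Set.mem_ofPred_eq] at hy ⊢
      constructor
      · rintro ⟨h1, h2⟩
        refine ⟨⟨h1, ?_⟩, by rwa [dist_comm]⟩
        have := dist_triangle z y x
        linarith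
      · rintro ⟨⟨h1, _⟩, h2⟩
        exact ⟨h1, by rwa [dist_comm]⟩
    simp only [cnt]
    rw [this, Set.ncard_coe_finset, Finset.card_filter]
    push_cast
    refine Finset.sum_congr rfl fun z _ => ?_
    simp [Set.indicator_apply]
  have hint : ∀ z ∈ F, Integrable ((ball z R).indicator (fun _ => (1 : ℝ)))
      (volume.restrict (ball x S)) := by
    intro z _
    refine IntegrableOn.integrable_indicator ?_ measurableSet_ball
    refine (integrableOn_const (μ := volume.restrict (ball x S)) ?_)
    exact ((Measure.restrict_apply_le _ _).trans_lt measure_ball_lt_top).ne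
  refine ⟨?_, ?_⟩
  · rw [integrableOn_congr_fun key measurableSet_ball]
    exact integrable_finsetSum _ hint
  · rw [setIntegral_congr_fun measurableSet_ball key, integral_finsetSum _ hint]
    refine Finset.sum_congr rfl fun z _ => ?_
    rw [integral_indicator measurableSet_ball]
    simp [Measure.real, Measure.restrict_apply measurableSet_ball]

lemma avg_lower {n : ℕ} {Γ : Set (EV n)} (h : UnifDisc Γ) {R c : ℝ}
    (hc : ∀ y, c ≤ cnt Γ y R) (x : EV n) (S : ℝ) :
    c * bv n S ≤ bv n R * cnt Γ x (S + R) := by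
  obtain ⟨hi, he⟩ := integral_cnt h x R S
  have h1 : ∫ y in ball x S, c ≤ ∫ y in ball x S, cnt Γ y R :=
    setIntegral_mono (integrableOn_const measure_ball_lt_top.ne) hi hc
  rw [he, setIntegral_const, smul_eq_mul, Measure.real, bv_eq] at h1
  have h2 : ∑ z ∈ (h.finite_ball x (S + R)).toFinset, (volume (ball z R ∩ ball x S)).toReal
      ≤ ∑ z ∈ (h.finite_ball x (S + R)).toFinset, bv n R := by
    refine Finset.sum_le_sum fun z _ => ?_
    rw [← bv_eq z]
    exact ENNReal.toReal_mono measure_ball_lt_top.ne (measure_mono Set.inter_subset_left)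
  rw [Finset.sum_const, nsmul_eq_mul, ← Set.ncard_eq_toFinset_card _ (h.finite_ball x _)] at h2
  unfold cnt
  linarith

lemma avg_upper {n : ℕ} {Γ : Set (EV n)} (h : UnifDisc Γ) {R c : ℝ} (hR : 0 ≤ R)
    (hc : ∀ y, cnt Γ y R ≤ c) (x : EV n) (S : ℝ) :
    bv n R * cnt Γ x (S - R) ≤ c * bv n S := by
  obtain ⟨hi, he⟩ := integral_cnt h x R S
  have h1 : ∫ y in ball x S, cnt Γ y R ≤ ∫ y in ball x S, c :=
    setIntegral_mono hi (integrableOn_const measure_ball_lt_top.ne) hc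
  rw [he, setIntegral_const, smul_eq_mul, Measure.real, bv_eq] at h1
  have h2 : ∑ z ∈ (h.finite_ball x (S - R)).toFinset, bv n R ≤
      ∑ z ∈ (h.finite_ball x (S + R)).toFinset, (volume (ball z R ∩ ball x S)).toReal := by
    calc _ ≤ ∑ z ∈ (h.finite_ball x (S - R)).toFinset, (volume (ball z R ∩ ball x S)).toReal := by
          refine Finset.sum_le_sum fun z hz => ?_
          rw [Set.inter_eq_left.2, bv_eq]
          refine ball_subset_ball' ?_
          have := ((h.finite_ball x (S - R)).mem_toFinset.1 hz).2
          rw [mem_ball] at this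
          linarith
      _ ≤ _ := by
          refine Finset.sum_le_sum_of_subset_of_nonneg ?_ fun _ _ _ => ENNReal.toReal_nonneg
          refine Set.Finite.toFinset_subset_toFinset.2 ?_
          exact Set.inter_subset_inter_right _ (ball_subset_ball (by linarith))
  rw [Finset.sum_const, nsmul_eq_mul, ← Set.ncard_eq_toFinset_card _ (h.finite_ball x _)] at h2
  unfold cnt
  linarith

/-- Key lemma: near constancy of counts at some scale gives uniform density. -/
lemma unif_dens {n : ℕ} {Γ : Set (EV n)} (h : UnifDisc Γ)
    (hc : ∀ ε > 0, ∃ R > 0, ∀ x y : EV n, cnt Γ x R ≤ cnt Γ y R + ε * bv n R) :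
    ∀ ε > 0, ∀ᶠ R in atTop, ∀ x : EV n, |cnt Γ x R / bv n R - upDens Γ| ≤ ε := by
  have main : ∀ ε > 0, ∃ d : ℝ, ∀ᶠ R in atTop, ∀ x : EV n, |cnt Γ x R / bv n R - d| ≤ ε := by
    intro ε hε
    obtain ⟨R, hR, hxy⟩ := hc (ε / 2) (by linarith)
    have hV := bv_pos n hR
    set d := cnt Γ 0 R / bv n R with hd
    have hd' : cnt Γ 0 R = d * bv n R := by rw [hd]; field_simp
    refine ⟨d, ?_⟩
    have hlo : ∀ y, (d - ε / 2) * bv n R ≤ cnt Γ y R := fun y => by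
      have := hxy 0 y; rw [hd'] at this; linarith
    have hup : ∀ y, cnt Γ y R ≤ (d + ε / 2) * bv n R := fun y => by
      have := hxy y 0; rw [hd'] at this; linarith
    have l1 : Tendsto (fun S => (d - ε / 2) * (bv n (S + -R) / bv n S)) atTop
        (nhds (d - ε / 2)) := by simpa using (bv_ratio n (-R)).const_mul (d - ε / 2)
    have l2 : Tendsto (fun S => (d + ε / 2) * (bv n (S + R) / bv n S)) atTop
        (nhds (d + ε / 2)) := by simpa using (bv_ratio n R).const_mul (d + ε / 2)
    filter_upwards [l1.eventually (lt_mem_nhds (show d - ε < d - ε / 2 by linarith)),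
      l2.eventually (gt_mem_nhds (show d + ε / 2 < d + ε by linarith)),
      eventually_gt_atTop 0] with S h1 h2 hS x
    have hVS := bv_pos n hS
    have a1 := avg_lower h hlo x (S + -R)
    have a2 := avg_upper h hR.le hup x (S + R)
    rw [neg_add_cancel_right] at a1
    rw [add_sub_cancel_right] at a2
    have b1 : (d - ε / 2) * bv n (S + -R) ≤ cnt Γ x S := by
      refine le_of_mul_le_mul_left ?_ hV; linarith
    have b2 : cnt Γ x S ≤ (d + ε / 2) * bv n (S + R) := by
      refine le_of_mul_le_mul_left ?_ hV; linarith
    have c1 : (d - ε / 2) * (bv n (S + -R) / bv n S) ≤ cnt Γ x S / bv n S := by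
      rw [← mul_div_assoc]; gcongr
    have c2 : cnt Γ x S / bv n S ≤ (d + ε / 2) * (bv n (S + R) / bv n S) := by
      rw [← mul_div_assoc]; gcongr
    rw [abs_le]; constructor <;> linarith
  intro ε hε
  obtain ⟨d, hd⟩ := main (ε / 2) (by linarith)
  have hsup : ∀ᶠ R in atTop, d - ε / 2 ≤ densR Γ R ∧ densR Γ R ≤ d + ε / 2 := by
    filter_upwards [hd] with R hR
    have e : densR Γ R = ⨆ x : EV n, cnt Γ x R / bv n R := by
      unfold densR; simp only [bv_eq]; rfl
    rw [e]
    constructor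
    · refine le_trans ?_ (le_ciSup (f := fun x : EV n => cnt Γ x R / bv n R) ⟨d + ε / 2, ?_⟩ 0)
      · have := (abs_le.1 (hR 0)).1; linarith
      · rintro _ ⟨x, rfl⟩
        have := (abs_le.1 (hR x)).2; dsimp only; linarith
    · refine ciSup_le fun x => ?_
      have := (abs_le.1 (hR x)).2; linarith
  have b1 : IsBoundedUnder (· ≤ ·) atTop (densR Γ) :=
    ⟨d + ε / 2, eventually_map.2 (hsup.mono fun _ h => h.2)⟩
  have b2 : IsBoundedUnder (· ≥ ·) atTop (densR Γ) :=
    ⟨d - ε / 2, eventually_map.2 (hsup.mono fun _ h => h.1)⟩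
  have u1 : upDens Γ ≤ d + ε / 2 :=
    limsup_le_of_le b2.isCoboundedUnder_le (hsup.mono fun _ h => h.2)
  have u2 : d - ε / 2 ≤ upDens Γ :=
    le_limsup_of_frequently_le (hsup.mono fun _ h => h.1).frequently b1
  filter_upwards [hd] with R hR x
  have := abs_le.1 (hR x)
  rw [abs_le]; constructor <;> linarith

lemma cnt_not_const {n : ℕ} [Nontrivial (EV n)] {Γ : Set (EV n)} (h : UnifDisc Γ)
    (hne : Γ.Nonempty) {R : ℝ} (hR : 0 < R) : ∃ x y : EV n, cnt Γ x R + 1 ≤ cnt Γ y R := by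
  obtain ⟨p, hp⟩ := hne
  obtain ⟨e, he⟩ := exists_norm_eq (EV n) (zero_le_one (α := ℝ))
  set x := p + R • e with hx
  have hfin := h.finite_ball x R
  have hpd : dist p x = R := by simp [hx, norm_smul, he, abs_of_pos hR]
  have ev : ∀ᶠ t in nhdsWithin (0 : ℝ) (Set.Ioi 0), ∀ z ∈ Γ ∩ ball x R, t < R - dist z x := by
    rw [eventually_all_finite hfin]
    intro z hz
    have := mem_ball.1 hz.2
    exact nhdsWithin_le_nhds (gt_mem_nhds (by linarith))
  have ev2 : ∀ᶠ t in nhdsWithin (0 : ℝ) (Set.Ioi 0), t < R := nhdsWithin_le_nhds (gt_mem_nhds hR)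
  obtain ⟨t, ht, htR, ht0⟩ := (ev.and (ev2.and self_mem_nhdsWithin)).exists
  have ht0 : 0 < t := ht0
  set y := p + (R - t) • e with hy
  have hxy : dist x y = t := by
    have : x - y = t • e := by rw [hx, hy, sub_smul]; abel
    rw [dist_eq_norm, this, norm_smul, he, Real.norm_of_nonneg ht0.le, mul_one]
  have hpy : dist p y = R - t := by
    simp [hy, norm_smul, he, abs_of_pos (sub_pos.2 htR)]
  refine ⟨x, y, ?_⟩
  have hsub : insert p (Γ ∩ ball x R) ⊆ Γ ∩ ball y R := by
    rintro z (rfl | hz)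
    · exact ⟨hp, by rw [mem_ball]; linarith⟩
    · refine ⟨hz.1, ?_⟩
      have := ht z hz
      have := dist_triangle z x y
      rw [mem_ball]; linarith
  have hnot : p ∉ Γ ∩ ball x R := fun hh => by
    have := mem_ball.1 hh.2; linarith
  have := Set.ncard_le_ncard hsub (h.finite_ball y R)
  rw [Set.ncard_insert_of_notMem hnot hfin] at this
  unfold cnt
  exact_mod_cast this

/-- The set of points `z` of `Γ` with `z + v ∈ Γ`. -/
def dset {n : ℕ} (Γ : Set (EV n)) (v : EV n) : Set (EV n) := {x ∈ Γ | x + v ∈ Γ}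

lemma dset_symm {n : ℕ} {A B : Set (EV n)} (hA : A.Finite) (hB : B.Finite) (v : EV n) :
    (dset A v).ncard ≤ (dset B v).ncard + 2 * (symmDiff A B).ncard := by
  have hs : (symmDiff A B).Finite := (hA.union hB).subset (by
    rintro z (hz | hz)
    · exact Or.inl hz.1
    · exact Or.inr hz.1)
  have hsub : dset A v ⊆ dset B v ∪ (symmDiff A B ∪ (fun z => z - v) '' symmDiff A B) := by
    rintro z ⟨h1, h2⟩
    by_cases hz : z ∈ B
    · by_cases hz' : z + v ∈ B
      · exact Or.inl ⟨hz, hz'⟩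
      · exact Or.inr (Or.inr ⟨z + v, Or.inl ⟨h2, hz'⟩, by simp⟩)
    · exact Or.inr (Or.inl (Or.inl ⟨h1, hz⟩))
  have hBf : (dset B v).Finite := hB.subset fun z hz => hz.1
  have h1 := Set.ncard_le_ncard hsub (hBf.union (hs.union (hs.image _)))
  have h2 := Set.ncard_union_le (dset B v) (symmDiff A B ∪ (fun z => z - v) '' symmDiff A B)
  have h3 := Set.ncard_union_le (symmDiff A B) ((fun z => z - v) '' symmDiff A B)
  have h4 := Set.ncard_image_le (f := fun z => z - v) hs
  omega

lemma dset_translate {n : ℕ} (A : Set (EV n)) (v w : EV n) :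
    (dset ((fun z => z - w) '' A) v).ncard = (dset A v).ncard := by
  have : dset ((fun z => z - w) '' A) v = (fun z => z - w) '' dset A v := by
    ext z
    constructor
    · rintro ⟨⟨a, ha, rfl⟩, ⟨b, hb, hab⟩⟩
      refine ⟨a, ⟨ha, ?_⟩, rfl⟩
      have : a + v = b := by
        have := hab
        simp only at this
        rw [sub_eq_iff_eq_add] at this
        rw [this]; abel
      rwa [this]
    · rintro ⟨a, ⟨ha, hb⟩, rfl⟩
      exact ⟨⟨a, ha, rfl⟩, ⟨a + v, hb, by simp only; abel⟩⟩
  rw [this, Set.ncard_image_of_injective _ (sub_left_injective)]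

lemma wap_cnt {n : ℕ} {Γ : Set (EV n)} (hwap : WAP Γ) :
    ∀ ε > 0, ∃ R > 0, ∀ x y : EV n, cnt Γ x R ≤ cnt Γ y R + ε * bv n R := by
  intro ε hε
  obtain ⟨hd, hw⟩ := hwap
  obtain ⟨R, hR, h⟩ := hw (ε / 2) (by linarith)
  refine ⟨R, hR, fun x y => ?_⟩
  obtain ⟨w, hw⟩ := h x y
  have h1 := dset_symm (hd.1.finite_ball x R) ((hd.1.finite_ball y R).image (fun z => z - w)) 0
  rw [dset_translate] at h1
  have e : ∀ A : Set (EV n), dset A 0 = A := fun A => by ext; simp [dset]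
  rw [e, e] at h1
  have h1' : cnt Γ x R ≤ cnt Γ y R + 2 * ((symmDiff (Γ ∩ ball x R)
    ((fun z => z - w) '' (Γ ∩ ball y R))).ncard : ℝ) := by unfold cnt; exact_mod_cast h1
  change _ ≤ ε / 2 * bv n R at hw
  linarith

lemma boundary {n : ℕ} {Γ : Set (EV n)} (hwap : WAP Γ) (a : ℝ) (ε : ℝ) (hε : 0 < ε) :
    ∀ᶠ R in atTop, ∀ x : EV n, cnt Γ x R - cnt Γ x (R - a) ≤ ε * bv n R := by
  have hu := unif_dens hwap.1.1 (wap_cnt hwap) (ε / 4) (by linarith)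
  have hu' := (tendsto_atTop_add_const_right atTop (-a) tendsto_id).eventually hu
  have l1 : Tendsto (fun S => (upDens Γ - ε / 4) * (bv n (S + -a) / bv n S)) atTop
      (nhds (upDens Γ - ε / 4)) := by simpa using (bv_ratio n (-a)).const_mul (upDens Γ - ε / 4)
  filter_upwards [hu, hu', eventually_gt_atTop 0, eventually_gt_atTop a,
    l1.eventually (lt_mem_nhds (show upDens Γ - ε / 2 < upDens Γ - ε / 4 by linarith))]
    with R h1 h2 hR ha h3 x
  have hV := bv_pos n hR
  have hV' := bv_pos n (by linarith : 0 < R + -a)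
  have h1 := (abs_le.1 (h1 x)).2
  have h2 := (abs_le.1 (h2 x)).1
  simp only [id] at h2
  have k1 : cnt Γ x R ≤ (upDens Γ + ε / 4) * bv n R := by
    rw [← div_le_iff₀ hV]; linarith
  have k2 : (upDens Γ - ε / 4) * bv n (R + -a) ≤ cnt Γ x (R + -a) := by
    rw [← le_div_iff₀ hV']; linarith
  have k3 : (upDens Γ - ε / 2) * bv n R ≤ (upDens Γ - ε / 4) * bv n (R + -a) := by
    rw [← mul_div_assoc] at h3
    exact ((lt_div_iff₀ hV).1 h3).le
  rw [← sub_eq_add_neg] at k2 k3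
  nlinarith

lemma cnt_dset_le {n : ℕ} {Γ : Set (EV n)} (h : UnifDisc Γ) (v x : EV n) (R : ℝ) :
    cnt (dset Γ v) x R ≤ (dset (Γ ∩ ball x R) v).ncard + (cnt Γ x R - cnt Γ x (R - ‖v‖)) ∧
    ((dset (Γ ∩ ball x R) v).ncard : ℝ) ≤ cnt (dset Γ v) x R := by
  have hfin := h.finite_ball x R
  have hss : Γ ∩ ball x (R - ‖v‖) ⊆ Γ ∩ ball x R :=
    Set.inter_subset_inter_right _ (ball_subset_ball (by linarith [norm_nonneg v]))
  constructor
  · have hsub : dset Γ v ∩ ball x R ⊆ dset (Γ ∩ ball x R) v ∪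
        ((Γ ∩ ball x R) \ (Γ ∩ ball x (R - ‖v‖))) := by
      rintro z ⟨⟨h1, h2⟩, h3⟩
      by_cases hz : z ∈ ball x (R - ‖v‖)
      · refine Or.inl ⟨⟨h1, h3⟩, h2, ?_⟩
        rw [mem_ball] at hz ⊢
        have := dist_triangle (z + v) z x
        have h5 : dist (z + v) z = ‖v‖ := by simp
        linarith
      · exact Or.inr ⟨⟨h1, h3⟩, fun hh => hz hh.2⟩
    have hf : (dset (Γ ∩ ball x R) v).Finite := hfin.subset fun z hz => hz.1
    have h1 := Set.ncard_le_ncard hsub (hf.union hfin.sdiff)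
    have h2 := Set.ncard_union_le (dset (Γ ∩ ball x R) v)
      ((Γ ∩ ball x R) \ (Γ ∩ ball x (R - ‖v‖)))
    have h3 := Set.ncard_sdiff_add_ncard_of_subset hss hfin
    have h4 : (dset Γ v ∩ ball x R).ncard + (Γ ∩ ball x (R - ‖v‖)).ncard ≤
      (dset (Γ ∩ ball x R) v).ncard + (Γ ∩ ball x R).ncard := by omega
    have h5 : ((dset Γ v ∩ ball x R).ncard : ℝ) + (Γ ∩ ball x (R - ‖v‖)).ncard ≤
      (dset (Γ ∩ ball x R) v).ncard + (Γ ∩ ball x R).ncard := by exact_mod_cast h4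
    unfold cnt
    linarith
  · unfold cnt
    have : dset (Γ ∩ ball x R) v ⊆ dset Γ v ∩ ball x R := by
      rintro z ⟨h1, h2⟩
      exact ⟨⟨h1.1, h2.1⟩, h1.2⟩
    exact_mod_cast Set.ncard_le_ncard this
      ((h.mono (Λ := dset Γ v) fun z hz => hz.1).finite_ball x R)

lemma wap_dset {n : ℕ} {Γ : Set (EV n)} (hwap : WAP Γ) (v : EV n) :
    ∀ ε > 0, ∃ R > 0, ∀ x y : EV n,
      cnt (dset Γ v) x R ≤ cnt (dset Γ v) y R + ε * bv n R := by
  intro ε hε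
  rcases subsingleton_or_nontrivial (EV n) with hS | hN
  · refine ⟨1, one_pos, fun x y => ?_⟩
    rw [Subsingleton.elim x y]
    nlinarith [bv_nonneg n 1]
  have hd := hwap.1.1
  have hne : Γ.Nonempty := by
    obtain ⟨R, _, h⟩ := hwap.1.2
    exact (h 0).mono Set.inter_subset_left
  obtain ⟨R₁, hR₁⟩ := eventually_atTop.1 (boundary hwap ‖v‖ (ε / 2) (by linarith))
  obtain ⟨δ, hδ, hδε, hδ1⟩ : ∃ δ > 0, δ ≤ ε / 4 ∧ 2 * δ * bv n R₁ < 1 := by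
    have hb := bv_nonneg n R₁
    refine ⟨min (ε / 4) (1 / (4 * (bv n R₁ + 1))), by positivity, min_le_left _ _, ?_⟩
    have h1 : min (ε / 4) (1 / (4 * (bv n R₁ + 1))) ≤ 1 / (4 * (bv n R₁ + 1)) := min_le_right _ _
    rw [le_div_iff₀ (by positivity)] at h1
    have : 0 < min (ε / 4) (1 / (4 * (bv n R₁ + 1))) := by positivity
    nlinarith
  obtain ⟨R, hR, h⟩ := hwap.2 δ hδ
  have comp : ∀ u x y : EV n, ((dset (Γ ∩ ball x R) u).ncard : ℝ) ≤
      (dset (Γ ∩ ball y R) u).ncard + 2 * δ * bv n R := by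
    intro u x y
    obtain ⟨w, hw⟩ := h x y
    have h1 := dset_symm (hd.finite_ball x R) ((hd.finite_ball y R).image (fun z => z - w)) u
    rw [dset_translate] at h1
    have h1' : ((dset (Γ ∩ ball x R) u).ncard : ℝ) ≤ (dset (Γ ∩ ball y R) u).ncard +
      2 * ((symmDiff (Γ ∩ ball x R) ((fun z => z - w) '' (Γ ∩ ball y R))).ncard : ℝ) := by
        exact_mod_cast h1
    change _ ≤ δ * bv n R at hw
    linarith
  have hRR : R₁ ≤ R := by
    by_contra! hlt
    obtain ⟨x, y, hxy⟩ := cnt_not_const hd hne hR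
    have h1 := comp 0 y x
    have e : ∀ A : Set (EV n), dset A 0 = A := fun A => by ext; simp [dset]
    rw [e, e] at h1
    change cnt Γ y R ≤ cnt Γ x R + _ at h1
    have := bv_mono n hlt.le
    nlinarith
  refine ⟨R, hR, fun x y => ?_⟩
  have h1 := (cnt_dset_le hd v x R).1
  have h2 := (cnt_dset_le hd v y R).2
  have h3 := hR₁ R hRR x
  have h4 := comp v x y
  have := bv_nonneg n R
  nlinarith

lemma upDens_empty {n : ℕ} : upDens (∅ : Set (EV n)) = 0 := by
  have : densR (∅ : Set (EV n)) = fun _ => 0 := by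
    funext R; simp [densR]
  rw [upDens, this]; simp

lemma double_count {n : ℕ} {Γ : Set (EV n)} (h : UnifDisc Γ) (hd : UnifDisc (Γ - Γ))
    (x : EV n) (R S : ℝ) :
    ∑ v ∈ (hd.finite_ball x R).toFinset, cnt (dset Γ v) 0 S =
      ∑ z ∈ (h.finite_ball 0 S).toFinset, cnt Γ (z + x) R := by
  classical
  set F := (hd.finite_ball x R).toFinset with hF
  set G := (h.finite_ball 0 S).toFinset with hG
  have e1 : ∀ v, cnt (dset Γ v) 0 S = ∑ z ∈ G, if z + v ∈ Γ then (1 : ℝ) else 0 := by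
    intro v
    have : dset Γ v ∩ ball 0 S = ((G.filter (fun z => z + v ∈ Γ) : Finset (EV n)) : Set (EV n)) := by
      ext z
      simp only [hG, dset, Finset.coe_filter, Set.Finite.mem_toFinset, Set.mem_inter_iff,
        Set.mem_ofPred_eq]
      tauto
    unfold cnt
    rw [this, Set.ncard_coe_finset, Finset.card_filter]
    push_cast
    rfl
  have e2 : ∀ z ∈ G, cnt Γ (z + x) R = ∑ v ∈ F, if z + v ∈ Γ then (1 : ℝ) else 0 := by
    intro z hz
    have hzΓ : z ∈ Γ := ((h.finite_ball 0 S).mem_toFinset.1 hz).1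
    have : Γ ∩ ball (z + x) R = (fun v => z + v) ''
        ((F.filter (fun v => z + v ∈ Γ) : Finset (EV n)) : Set (EV n)) := by
      ext u
      simp only [hF, Finset.coe_filter, Set.Finite.mem_toFinset, Set.mem_inter_iff,
        Set.mem_ofPred_eq, Set.mem_image]
      constructor
      · rintro ⟨h1, h2⟩
        refine ⟨u - z, ⟨⟨Set.sub_mem_sub h1 hzΓ, ?_⟩, by simpa using h1⟩, by abel⟩
        rw [mem_ball, dist_eq_norm] at h2 ⊢
        rwa [sub_sub]
      · rintro ⟨v, ⟨⟨_, h2⟩, h3⟩, rfl⟩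
        refine ⟨h3, ?_⟩
        rw [mem_ball] at h2 ⊢
        rwa [dist_add_left]
    unfold cnt
    rw [this, Set.ncard_image_of_injective _ (add_right_injective z), Set.ncard_coe_finset,
      Finset.card_filter]
    push_cast
    rfl
  rw [Finset.sum_congr rfl e2, Finset.sum_congr rfl fun v _ => e1 v, Finset.sum_comm]

/-- for a Meyer weakly almost periodic set, the frequency function
admits a mean, equal to the uniform density D(Γ) = D⁺(Γ). -/
theorem freq_mean {n : ℕ} (Γ : Set (EuclideanSpace ℝ (Fin n)))
    (hmeyer : Meyer Γ) (hwap : WAP Γ) :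
    ∀ ε > 0, ∃ R₀ > 0, ∀ R ≥ R₀, ∀ x : EuclideanSpace ℝ (Fin n),
      |(1 / (volume (ball x R)).toReal) *
          (∑' v : ball x R, freq Γ (v : EuclideanSpace ℝ (Fin n))) - upDens Γ| < ε := by
  intro ε hε
  have hu := hmeyer.1.1
  have hd := hmeyer.2.1
  have hΓ := unif_dens hu (wap_cnt hwap)
  obtain ⟨R₁, hR₁⟩ := eventually_atTop.1 (hΓ (ε / 2) (by linarith))
  refine ⟨max R₁ 1, by positivity, fun R hR x => ?_⟩
  have hR0 : 0 < R := lt_of_lt_of_le one_pos ((le_max_right _ _).trans hR)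
  have hRR := hR₁ R ((le_max_left _ _).trans hR)
  have hV := bv_pos n hR0
  set D := upDens Γ with hD
  set F := (hd.finite_ball x R).toFinset with hF
  have hts : (∑' v : ball x R, freq Γ (v : EuclideanSpace ℝ (Fin n))) =
      (∑ v ∈ F, upDens (dset Γ v)) / D := by
    rw [tsum_subtype (ball x R) (freq Γ), tsum_eq_sum (s := F), Finset.sum_div]
    · refine Finset.sum_congr rfl fun v hv => ?_
      rw [Set.indicator_of_mem ((hd.finite_ball x R).mem_toFinset.1 hv).2]
      rfl
    · intro v hv
      by_cases hvb : v ∈ ball x R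
      · rw [Set.indicator_of_mem hvb]
        have : dset Γ v = ∅ := by
          refine Set.eq_empty_iff_forall_notMem.2 fun z hz => hv ?_
          refine (hd.finite_ball x R).mem_toFinset.2 ⟨?_, hvb⟩
          exact ⟨z + v, hz.2, z, hz.1, by simp⟩
        change upDens (dset Γ v) / _ = 0
        rw [this, upDens_empty, zero_div]
      · exact Set.indicator_of_notMem hvb _
  rw [hts, bv_eq]
  by_cases hD0 : D = 0
  · simp [hD0, hε]
  have lim : ∀ Λ : Set (EV n), UnifDisc Λ →
      (∀ ε > 0, ∃ R > 0, ∀ x y : EV n, cnt Λ x R ≤ cnt Λ y R + ε * bv n R) →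
      Tendsto (fun S => cnt Λ 0 S / bv n S) atTop (nhds (upDens Λ)) := by
    intro Λ h1 h2
    rw [Metric.tendsto_nhds]
    intro η hη
    filter_upwards [unif_dens h1 h2 (η / 2) (by linarith)] with S hS
    rw [Real.dist_eq]
    linarith [hS 0]
  have limD := lim Γ hu (wap_cnt hwap)
  have limS : Tendsto (fun S => ∑ v ∈ F, cnt (dset Γ v) 0 S / bv n S) atTop
      (nhds (∑ v ∈ F, upDens (dset Γ v))) :=
    tendsto_finsetSum _ fun v _ => lim _ (hu.mono fun z hz => hz.1) (wap_dset hwap v)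
  have hbd : ∀ S > 0, |∑ v ∈ F, cnt (dset Γ v) 0 S / bv n S - D * bv n R * (cnt Γ 0 S / bv n S)|
      ≤ ε / 2 * bv n R * (cnt Γ 0 S / bv n S) := by
    intro S hS
    have hVS := bv_pos n hS
    have hN : cnt Γ 0 S = ∑ z ∈ (hu.finite_ball 0 S).toFinset, (1 : ℝ) := by
      unfold cnt; rw [Set.ncard_eq_toFinset_card _ (hu.finite_ball 0 S)]; simp
    rw [← Finset.sum_div, double_count hu hd x R S, ← mul_div_assoc, ← mul_div_assoc, ← sub_div,
      abs_div, abs_of_pos hVS]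
    gcongr
    rw [hN, Finset.mul_sum, Finset.mul_sum, ← Finset.sum_sub_distrib]
    refine (Finset.abs_sum_le_sum_abs _ _).trans (Finset.sum_le_sum fun z _ => ?_)
    have := hRR (z + x)
    rw [div_sub' hV.ne', abs_div, abs_of_pos hV, div_le_iff₀ hV] at this
    rw [mul_one, mul_one, mul_comm D]
    exact this
  have hlim : |∑ v ∈ F, upDens (dset Γ v) - D * bv n R * D| ≤ ε / 2 * bv n R * D :=
    le_of_tendsto_of_tendsto (limS.sub (limD.const_mul (D * bv n R))).abs
      (limD.const_mul (ε / 2 * bv n R))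
      ((eventually_gt_atTop 0).mono fun S hS => hbd S hS)
  have hDnn : 0 ≤ D := ge_of_tendsto limD (Eventually.of_forall fun S =>
    div_nonneg (Nat.cast_nonneg _) (bv_nonneg n S))
  have hDpos : 0 < D := lt_of_le_of_ne hDnn (Ne.symm hD0)
  have hfin : (1 / bv n R) * ((∑ v ∈ F, upDens (dset Γ v)) / D) - D =
      (∑ v ∈ F, upDens (dset Γ v) - D * bv n R * D) / (bv n R * D) := by
    field_simp
  have hP : 0 < bv n R * D := by positivity
  rw [hfin, abs_div, abs_of_pos hP, div_lt_iff₀ hP]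
  nlinarith
end

section
/- Let ᾱ = (α₁,…,α_n) with (1, α₁,…,α_n) linearly independent over ℚ, N a norm on ℝⁿ, ε > 0, and suppose the window W = {x : N(x) < ε} satisfies W ∩ (W + m) = ∅ for all m ∈ ℤⁿ \ {0}. Let E = {y ∈ ℤ : ∃x ∈ ℤⁿ, N(yᾱ − x) < ε}. Then for every d > 0, ∑_{u ∈ ℤ, |u| ≤ d} ρ_E(u) ≥ d·Vol(W); i.e., the average number of points of E within distance d of a given point of E is at least d·Vol(W). -/
open Filter MeasureTheory Metric Pointwise

variable {E : Type*} [NormedAddCommGroup E] [MeasureSpace E]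

/-- integers in an open ball -/
noncomputable def ibB (x R : ℝ) : Finset ℤ := Finset.Ioo ⌊x - R⌋ ⌈x + R⌉

lemma mem_ibB {x R : ℝ} {m : ℤ} : m ∈ ibB x R ↔ (m : ℝ) ∈ ball x R := by
  simp only [ibB, Finset.mem_Ioo, Int.floor_lt, Int.lt_ceil, Real.ball_eq_Ioo, Set.mem_Ioo]

lemma card_ibB {x R : ℝ} (hR : 0 ≤ R) : ((ibB x R).card : ℝ) ≤ 2 * R + 1 := by
  have h1 := Int.lt_floor_add_one (x - R)
  have h2 := Int.ceil_lt_add_one (x + R)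
  unfold ibB
  rw [Int.card_Ioo]
  rcases le_total 0 (⌈x + R⌉ - ⌊x - R⌋ - 1) with h | h
  · have : (((⌈x + R⌉ - ⌊x - R⌋ - 1).toNat : ℤ) : ℝ) = ((⌈x + R⌉ - ⌊x - R⌋ - 1 : ℤ) : ℝ) := by
      rw [Int.toNat_of_nonneg h]
    rw [Int.cast_natCast] at this
    rw [this]; push_cast; linarith
  · rw [Int.toNat_of_nonpos h]; push_cast; linarith

open Classical in
lemma ncard_eq_ibB (A : Set ℤ) (x R : ℝ) :
    (((↑) : ℤ → ℝ) '' A ∩ ball x R).ncard = ((ibB x R).filter (· ∈ A)).card := by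
  have : (((↑) : ℤ → ℝ) '' A ∩ ball x R) =
      ((↑) : ℤ → ℝ) '' (((ibB x R).filter (· ∈ A) : Finset ℤ) : Set ℤ) := by
    ext t
    simp only [Set.mem_inter_iff, Set.mem_image, Finset.coe_filter, Set.mem_ofPred_eq, mem_ibB]
    constructor
    · rintro ⟨⟨a, ha, rfl⟩, h⟩
      exact ⟨a, ⟨h, ha⟩, rfl⟩
    · rintro ⟨a, ⟨h, ha⟩, rfl⟩
      exact ⟨⟨a, ha, rfl⟩, h⟩
  rw [this, Set.ncard_image_of_injective _ Int.cast_injective, Set.ncard_coe_finset]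

lemma ib_quot_le (A : Set ℤ) (x : ℝ) {R : ℝ} (hR : 1 ≤ R) :
    ((((↑) : ℤ → ℝ) '' A ∩ ball x R).ncard : ℝ) / (volume (ball x R)).toReal ≤ 2 := by
  classical
  rw [ncard_eq_ibB, Real.volume_ball, ENNReal.toReal_ofReal (by linarith)]
  have h1 := card_ibB (x := x) (R := R) (by linarith)
  have h2 : (((ibB x R).filter (· ∈ A)).card : ℝ) ≤ (ibB x R).card := by
    exact_mod_cast Finset.card_filter_le _ _
  rw [div_le_iff₀ (by linarith)]
  linarith

lemma ib_bdd (A : Set ℤ) {R : ℝ} (hR : 1 ≤ R) : BddAbove (Set.range fun x : ℝ =>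
    ((((↑) : ℤ → ℝ) '' A ∩ ball x R).ncard : ℝ) / (volume (ball x R)).toReal) := by
  refine ⟨2, ?_⟩
  rintro _ ⟨x, rfl⟩
  exact ib_quot_le A x hR

lemma densR_nonneg' (Γ : Set ℝ) (R : ℝ) : 0 ≤ densR Γ R :=
  Real.iSup_nonneg fun x => by positivity

lemma densR_le_two (A : Set ℤ) {R : ℝ} (hR : 1 ≤ R) :
    densR (((↑) : ℤ → ℝ) '' A) R ≤ 2 := ciSup_le fun x => ib_quot_le A x hR

open Classical in
lemma le_densR (A : Set ℤ) (x : ℝ) {R : ℝ} (hR : 1 ≤ R) :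
    (((ibB x R).filter (· ∈ A)).card : ℝ) / (2 * R) ≤ densR (((↑) : ℤ → ℝ) '' A) R := by
  have := le_ciSup (ib_bdd A hR) x
  rw [ncard_eq_ibB, Real.volume_ball, ENNReal.toReal_ofReal (by linarith)] at this
  exact this

open Classical in
lemma exists_lt_densR (A : Set ℤ) {R c : ℝ} (hR : 1 ≤ R)
    (h : c < densR (((↑) : ℤ → ℝ) '' A) R) :
    ∃ x : ℝ, c < (((ibB x R).filter (· ∈ A)).card : ℝ) / (2 * R) := by
  obtain ⟨x, hx⟩ := exists_lt_of_lt_ciSup h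
  refine ⟨x, ?_⟩
  rw [ncard_eq_ibB, Real.volume_ball, ENNReal.toReal_ofReal (by linarith)] at hx
  exact hx

lemma densR_bdd (A : Set ℤ) :
    IsBoundedUnder (· ≤ ·) atTop (densR (((↑) : ℤ → ℝ) '' A)) :=
  ⟨2, eventually_map.2 <| (eventually_ge_atTop 1).mono fun _ hR => densR_le_two A hR⟩

lemma densR_cobdd (Γ : Set ℝ) :
    IsCoboundedUnder (· ≤ ·) atTop (densR Γ) :=
  IsBoundedUnder.isCoboundedUnder_le (l := atTop)
    ⟨0, eventually_map.2 <| Eventually.of_forall fun R => densR_nonneg' Γ R⟩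

lemma upDens_nonneg' (A : Set ℤ) : 0 ≤ upDens (((↑) : ℤ → ℝ) '' A) :=
  le_limsup_of_frequently_le (Frequently.of_forall fun R => densR_nonneg' _ R) (densR_bdd A)

/-- the points of `A` whose translate by `u` lies in `A` -/
def shA (A : Set ℤ) (u : ℤ) : Set ℤ := {a | a ∈ A ∧ a + u ∈ A}

lemma mem_shA {A : Set ℤ} {u a : ℤ} : a ∈ shA A u ↔ a ∈ A ∧ a + u ∈ A := Iff.rfl

open Classical in
lemma card_ib_shift (A : Set ℤ) (x R : ℝ) (j k : ℕ) :
    ((ibB x R).filter (fun m : ℤ => m + j ∈ A ∧ m + k ∈ A)).card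
      = ((ibB (x + j) R).filter (· ∈ shA A ((k : ℤ) - j))).card := by
  refine Finset.card_bij (fun m _ => m + j) ?_ ?_ ?_
  · intro m hm
    simp only [Finset.mem_filter, mem_ibB, Real.ball_eq_Ioo, Set.mem_Ioo, mem_shA] at hm ⊢
    push_cast
    refine ⟨⟨by linarith, by linarith⟩, hm.2.1, ?_⟩
    convert hm.2.2 using 1; ring
  · intro a _ b _ h
    simpa using h
  · intro m hm
    simp only [Finset.mem_filter, mem_ibB, Real.ball_eq_Ioo, Set.mem_Ioo, mem_shA] at hm
    refine ⟨m - j, ?_, by ring⟩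
    simp only [Finset.mem_filter, mem_ibB, Real.ball_eq_Ioo, Set.mem_Ioo]
    push_cast
    refine ⟨⟨by linarith, by linarith⟩, ?_, ?_⟩
    · simpa using hm.2.1
    · convert hm.2.2 using 1; ring

open Classical in
lemma card_ib_le_shift (A : Set ℤ) (x R : ℝ) (K k : ℕ) (hk : k ≤ K) :
    ((ibB x R).filter (· ∈ A)).card
      ≤ ((ibB x (R + K)).filter (fun m : ℤ => m + k ∈ A)).card := by
  refine Finset.card_le_card_of_injOn (fun m => m - k) ?_ ?_
  · intro m hm
    have hkr : (k : ℝ) ≤ K := by exact_mod_cast hk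
    have hk0 : (0 : ℝ) ≤ k := by positivity
    simp only [Finset.coe_filter, mem_ibB, Real.ball_eq_Ioo, Set.mem_Ioo, Set.mem_ofPred_eq] at hm ⊢
    push_cast
    refine ⟨⟨by linarith, by linarith⟩, by simpa using hm.2⟩
  · intro a _ b _ h
    simpa using h

open Classical in
lemma ib_key (A : Set ℤ) (x : ℝ) {R : ℝ} (K : ℕ) (hR : 1 ≤ R) :
    ((K : ℝ) * ((ibB x R).filter (· ∈ A)).card) ^ 2
      ≤ (2 * (R + K) + 1) * ((2 * (R + K)) * ∑ j ∈ Finset.range K, ∑ k ∈ Finset.range K,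
          densR (((↑) : ℤ → ℝ) '' (shA A ((k : ℤ) - j))) (R + K)) := by
  have hK : (0 : ℝ) ≤ K := by positivity
  set B := ibB x (R + K) with hB
  set F : ℤ → ℝ := fun m => ∑ k ∈ Finset.range K, if m + k ∈ A then (1 : ℝ) else 0 with hF
  have h1 : (K : ℝ) * ((ibB x R).filter (· ∈ A)).card ≤ ∑ m ∈ B, F m := by
    rw [hF, Finset.sum_comm]
    calc (K : ℝ) * ((ibB x R).filter (· ∈ A)).card
        = ∑ k ∈ Finset.range K, (((ibB x R).filter (· ∈ A)).card : ℝ) := by simp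
      _ ≤ _ := by
        refine Finset.sum_le_sum fun k hk => ?_
        rw [Finset.sum_boole]
        exact_mod_cast card_ib_le_shift A x R K k (Finset.mem_range.1 hk).le
  have h2 : (∑ m ∈ B, F m) ^ 2 ≤ B.card * ∑ m ∈ B, F m ^ 2 := sq_sum_le_card_mul_sum_sq
  have h3 : ∑ m ∈ B, F m ^ 2 ≤ (2 * (R + K)) * ∑ j ∈ Finset.range K, ∑ k ∈ Finset.range K,
          densR (((↑) : ℤ → ℝ) '' (shA A ((k : ℤ) - j))) (R + K) := by
    have : ∑ m ∈ B, F m ^ 2 = ∑ j ∈ Finset.range K, ∑ k ∈ Finset.range K,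
        ((B.filter (fun m : ℤ => m + j ∈ A ∧ m + k ∈ A)).card : ℝ) := by
      simp only [hF, sq, Finset.sum_mul_sum]
      rw [Finset.sum_comm]
      refine Finset.sum_congr rfl fun j _ => ?_
      rw [Finset.sum_comm]
      refine Finset.sum_congr rfl fun k _ => ?_
      rw [← Finset.sum_boole]
      refine Finset.sum_congr rfl fun m _ => ?_
      by_cases h : m + (j : ℤ) ∈ A <;> by_cases h' : m + (k : ℤ) ∈ A <;> simp [h, h']
    rw [this, Finset.mul_sum]
    refine Finset.sum_le_sum fun j _ => ?_
    rw [Finset.mul_sum]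
    refine Finset.sum_le_sum fun k _ => ?_
    rw [hB, card_ib_shift]
    have := le_densR (shA A ((k : ℤ) - j)) (x + j) (R := R + K) (by linarith)
    rw [div_le_iff₀ (by linarith)] at this
    linarith
  calc _ ≤ (∑ m ∈ B, F m) ^ 2 := by gcongr
    _ ≤ B.card * ∑ m ∈ B, F m ^ 2 := h2
    _ ≤ _ := by
      gcongr
      exact card_ibB (by linarith)

lemma upDens_key (A : Set ℤ) (K : ℕ) (hD : 0 < upDens (((↑) : ℤ → ℝ) '' A)) :
    ((K : ℝ) * upDens (((↑) : ℤ → ℝ) '' A)) ^ 2 ≤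
      ∑ j ∈ Finset.range K, ∑ k ∈ Finset.range K,
          upDens (((↑) : ℤ → ℝ) '' (shA A ((k : ℤ) - j))) := by
  classical
  set D := upDens (((↑) : ℤ → ℝ) '' A) with hDdef
  set r : ℕ → ℕ → ℝ := fun j k => upDens (((↑) : ℤ → ℝ) '' (shA A ((k : ℤ) - j))) with hr
  have main : ∀ δ ∈ Set.Ioo 0 D, ((K : ℝ) * (D - δ)) ^ 2 ≤
      (1 + δ) * ∑ j ∈ Finset.range K, ∑ k ∈ Finset.range K, (r j k + δ) := by
    rintro δ ⟨hδ, hδD⟩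
    have e1 : ∀ᶠ R : ℝ in atTop, ∀ j ∈ Finset.range K, ∀ k ∈ Finset.range K,
        densR (((↑) : ℤ → ℝ) '' (shA A ((k : ℤ) - j))) (R + K) ≤ r j k + δ := by
      rw [Filter.eventually_all_finset]; intro j _
      rw [Filter.eventually_all_finset]; intro k _
      have : ∀ᶠ R : ℝ in atTop, densR (((↑) : ℤ → ℝ) '' (shA A ((k : ℤ) - j))) R < r j k + δ :=
        eventually_lt_of_limsup_lt (by
          change upDens _ < _
          simp only [hr]; linarith) (densR_bdd _)
      exact ((tendsto_atTop_add_const_right atTop (K : ℝ) tendsto_id).eventually this).mono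
        fun R h => h.le
    have e2 : ∃ᶠ R : ℝ in atTop, D - δ < densR (((↑) : ℤ → ℝ) '' A) R :=
      frequently_lt_of_lt_limsup (densR_cobdd _) (by
        change _ < upDens _
        linarith)
    have e3 : ∀ᶠ R : ℝ in atTop, (2 * (R + K) + 1) * (2 * (R + K)) ≤ (1 + δ) * (2 * R) ^ 2 := by
      filter_upwards [eventually_ge_atTop 1,
        eventually_ge_atTop (((2 * K + 1) * (2 * K) + 8 * K + 2) / δ)] with R h1 h2
      rw [div_le_iff₀ hδ] at h2
      have hK : (0 : ℝ) ≤ K := by positivity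
      have h3 : ((2 * K + 1) * (2 * K) + 8 * K + 2) * R ≤ R * δ * R := by gcongr
      nlinarith [mul_nonneg hK hK, mul_nonneg (mul_nonneg hK hK) (sub_nonneg.2 h1), mul_nonneg hK (sub_nonneg.2 h1), mul_pos hδ (mul_pos (zero_lt_one.trans_le h1) (zero_lt_one.trans_le h1))]
    obtain ⟨R, hR2, hR1, hR3, hR⟩ :=
      (e2.and_eventually (e1.and (e3.and (eventually_ge_atTop 1)))).exists
    obtain ⟨x, hx⟩ := exists_lt_densR A hR hR2
    rw [lt_div_iff₀ (by linarith)] at hx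
    have hkey := ib_key A x K hR
    have hS0 : 0 ≤ ∑ j ∈ Finset.range K, ∑ k ∈ Finset.range K, (r j k + δ) :=
      Finset.sum_nonneg fun j _ => Finset.sum_nonneg fun k _ => by
        have := upDens_nonneg' (shA A ((k : ℤ) - j))
        simp only [hr]; linarith
    have hK : (0 : ℝ) ≤ K := by positivity
    have hS1 : ∑ j ∈ Finset.range K, ∑ k ∈ Finset.range K,
          densR (((↑) : ℤ → ℝ) '' (shA A ((k : ℤ) - j))) (R + K) ≤
        ∑ j ∈ Finset.range K, ∑ k ∈ Finset.range K, (r j k + δ) :=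
      Finset.sum_le_sum fun j hj => Finset.sum_le_sum fun k hk => hR1 j hj k hk
    generalize ∑ j ∈ Finset.range K, ∑ k ∈ Finset.range K, (r j k + δ) = S at hS0 hS1 ⊢
    generalize ∑ j ∈ Finset.range K, ∑ k ∈ Finset.range K,
          densR (((↑) : ℤ → ℝ) '' (shA A ((k : ℤ) - j))) (R + K) = S' at hS1 hkey
    have hc : ((K : ℝ) * (D - δ)) ^ 2 * (2 * R) ^ 2 ≤ ((1 + δ) * S) * (2 * R) ^ 2 := by
      have h0 : 0 ≤ (D - δ) * (2 * R) := mul_nonneg (by linarith) (by linarith)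
      have h1 : ((K : ℝ) * ((D - δ) * (2 * R))) ^ 2 ≤
          ((K : ℝ) * ((ibB x R).filter (· ∈ A)).card) ^ 2 :=
        pow_le_pow_left₀ (mul_nonneg hK h0) (mul_le_mul_of_nonneg_left hx.le hK) 2
      have h2 : (2 * (R + K) + 1) * ((2 * (R + K)) * S') ≤ (2 * (R + K) + 1) * ((2 * (R + K)) * S) :=
        mul_le_mul_of_nonneg_left (mul_le_mul_of_nonneg_left hS1 (by linarith)) (by linarith)
      have h3 := mul_le_mul_of_nonneg_right hR3 hS0
      linarith
    exact le_of_mul_le_mul_right hc (by positivity)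
  have t1 : Tendsto (fun δ : ℝ => ((K : ℝ) * (D - δ)) ^ 2) (nhdsWithin 0 (Set.Ioi 0))
      (nhds (((K : ℝ) * (D - 0)) ^ 2)) :=
    (Continuous.tendsto (by fun_prop) 0).mono_left nhdsWithin_le_nhds
  have t2 : Tendsto (fun δ : ℝ => (1 + δ) * ∑ j ∈ Finset.range K, ∑ k ∈ Finset.range K, (r j k + δ))
      (nhdsWithin 0 (Set.Ioi 0))
      (nhds ((1 + 0) * ∑ j ∈ Finset.range K, ∑ k ∈ Finset.range K, (r j k + 0))) :=
    (Continuous.tendsto (by fun_prop) 0).mono_left nhdsWithin_le_nhds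
  have := le_of_tendsto_of_tendsto t1 t2 (by
    filter_upwards [Ioo_mem_nhdsGT hD] with δ hδ using main δ hδ)
  simpa using this

lemma upDens_final (A : Set ℤ) (K : ℕ) (hK : 0 < K) (hD : 0 < upDens (((↑) : ℤ → ℝ) '' A)) :
    (K : ℝ) * upDens (((↑) : ℤ → ℝ) '' A) ≤
      ∑ u ∈ Finset.Ioo (-(K : ℤ)) K,
          upDens (((↑) : ℤ → ℝ) '' (shA A u)) / upDens (((↑) : ℤ → ℝ) '' A) := by
  have h := upDens_key A K hD
  set D := upDens (((↑) : ℤ → ℝ) '' A) with hDdef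
  rw [← Finset.sum_div, le_div_iff₀ hD]
  have h2 : ∑ j ∈ Finset.range K, ∑ k ∈ Finset.range K,
          upDens (((↑) : ℤ → ℝ) '' (shA A ((k : ℤ) - j))) ≤
      ∑ j ∈ Finset.range K, ∑ u ∈ Finset.Ioo (-(K : ℤ)) K, upDens (((↑) : ℤ → ℝ) '' (shA A u)) := by
    refine Finset.sum_le_sum fun j hj => ?_
    have hinj : Set.InjOn (fun k : ℕ => (k : ℤ) - j) (Finset.range K : Set ℕ) := by
      intro a _ b _ h
      simpa using h
    rw [← Finset.sum_image (f := fun u => upDens (((↑) : ℤ → ℝ) '' (shA A u)))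
      (g := fun k : ℕ => (k : ℤ) - j) hinj]
    refine Finset.sum_le_sum_of_subset_of_nonneg ?_ fun u _ _ => upDens_nonneg' _
    intro u hu
    simp only [Finset.mem_image, Finset.mem_range, Finset.mem_Ioo] at hu hj ⊢
    obtain ⟨k, hk, rfl⟩ := hu
    omega
  rw [Finset.sum_const, Finset.card_range, nsmul_eq_mul] at h2
  have hK' : (0 : ℝ) < K := by exact_mod_cast hK
  refine le_of_mul_le_mul_left ?_ hK'
  calc (K : ℝ) * (K * D * D) = (K * D) ^ 2 := by ring
    _ ≤ _ := h.trans h2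

/-- the orbit point -/
noncomputable def orbA {n : ℕ} (α : Fin n → ℝ) : UnitAddTorus (Fin n) :=
  fun i => ((α i : ℝ) : UnitAddCircle)

lemma mFourier_add_apply {n : ℕ} (k : Fin n → ℤ) (x y : UnitAddTorus (Fin n)) :
    UnitAddTorus.mFourier k (x + y) = UnitAddTorus.mFourier k x * UnitAddTorus.mFourier k y := by
  simp only [UnitAddTorus.mFourier, ContinuousMap.coe_mk, ← Finset.prod_mul_distrib, Pi.add_apply]
  refine Finset.prod_congr rfl fun i _ => ?_
  simp only [fourier_apply, smul_add, AddCircle.toCircle_add, Circle.coe_mul]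

lemma mFourier_nsmul_apply {n : ℕ} (k : Fin n → ℤ) (x : UnitAddTorus (Fin n)) (m : ℕ) :
    UnitAddTorus.mFourier k (m • x) = UnitAddTorus.mFourier k x ^ m := by
  induction m with
  | zero => simp [UnitAddTorus.mFourier]
  | succ m ih => rw [succ_nsmul, mFourier_add_apply, ih, pow_succ]

lemma mFourier_norm_apply {n : ℕ} (k : Fin n → ℤ) (x : UnitAddTorus (Fin n)) :
    ‖UnitAddTorus.mFourier k x‖ = 1 := by
  simp only [UnitAddTorus.mFourier, fourier_apply, ContinuousMap.coe_mk, norm_prod, Circle.norm_coe,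
      Finset.prod_const_one]

lemma mFourier_orbA_ne {n : ℕ} (α : Fin n → ℝ)
    (hind : ∀ (q : ℚ) (c : Fin n → ℚ), (q : ℝ) + ∑ i, (c i : ℝ) * α i = 0 →
      q = 0 ∧ ∀ i, c i = 0) (k : Fin n → ℤ) (hk : k ≠ 0) :
    UnitAddTorus.mFourier k (orbA α) ≠ 1 := by
  intro h
  have h1 : UnitAddTorus.mFourier k (orbA α)
      = Complex.exp (((∑ i, (k i : ℝ) * α i : ℝ) : ℂ) * (2 * Real.pi * Complex.I)) := by
    simp only [UnitAddTorus.mFourier, ContinuousMap.coe_mk, orbA]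
    push_cast
    rw [Finset.sum_mul, Complex.exp_sum]
    refine Finset.prod_congr rfl fun i _ => ?_
    rw [fourier_coe_apply]
    congr 1
    push_cast
    ring
  rw [h1, Complex.exp_eq_one_iff] at h
  obtain ⟨m, hm⟩ := h
  have h2 : ((∑ i, (k i : ℝ) * α i : ℝ) : ℂ) = m :=
    mul_right_cancel₀ Complex.two_pi_I_ne_zero hm
  have h3 : ∑ i, (k i : ℝ) * α i = m := by exact_mod_cast h2
  have h4 := (hind (-(m : ℚ)) (fun i => (k i : ℚ)) (by push_cast; rw [h3]; ring)).2
  apply hk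
  funext i
  simpa using h4 i

lemma integral_mFourier_zero {n : ℕ} (k : Fin n → ℤ) (a : UnitAddTorus (Fin n))
    (h : UnitAddTorus.mFourier k a ≠ 1) :
    ∫ x : UnitAddTorus (Fin n), UnitAddTorus.mFourier k x = 0 := by
  have h1 : ∫ x : UnitAddTorus (Fin n), UnitAddTorus.mFourier k (x + a) =
      ∫ x : UnitAddTorus (Fin n), UnitAddTorus.mFourier k x :=
    integral_add_right_eq_self (fun x => UnitAddTorus.mFourier k x) a
  simp only [mFourier_add_apply] at h1
  rw [integral_mul_const] at h1
  have h2 : (∫ x : UnitAddTorus (Fin n), UnitAddTorus.mFourier k x) *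
      (UnitAddTorus.mFourier k a - 1) = 0 := by rw [mul_sub, h1]; ring
  exact (mul_eq_zero.1 h2).resolve_right (sub_ne_zero.2 h)

lemma torus_univ (n : ℕ) : (volume : Measure (UnitAddTorus (Fin n))) Set.univ = 1 := by
  rw [volume_pi, Measure.pi_univ]
  simp

instance torusProb (n : ℕ) : IsProbabilityMeasure (volume : Measure (UnitAddTorus (Fin n))) :=
  ⟨torus_univ n⟩

/-- orbit averages -/
noncomputable def orbAv {n : ℕ} (α : Fin n → ℝ) (L : ℕ) (f : C(UnitAddTorus (Fin n), ℂ)) : ℂ :=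
  (L : ℂ)⁻¹ * ∑ y ∈ Finset.range L, f (y • orbA α)

lemma orbAv_dist {n : ℕ} (α : Fin n → ℝ) (L : ℕ) (f g : C(UnitAddTorus (Fin n), ℂ)) :
    ‖orbAv α L f - orbAv α L g‖ ≤ ‖f - g‖ := by
  unfold orbAv
  rw [← mul_sub, ← Finset.sum_sub_distrib, norm_mul, norm_inv, Complex.norm_natCast]
  rcases Nat.eq_zero_or_pos L with rfl | hL
  · simp
  have hL' : (0 : ℝ) < L := by exact_mod_cast hL
  rw [inv_mul_le_iff₀ hL']
  calc _ ≤ ∑ y ∈ Finset.range L, ‖f (y • orbA α) - g (y • orbA α)‖ := norm_sum_le _ _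
    _ ≤ ∑ y ∈ Finset.range L, ‖f - g‖ :=
      Finset.sum_le_sum fun y _ => (f - g).norm_coe_le_norm (y • orbA α)
    _ = _ := by simp

lemma torus_integrable {n : ℕ} {F : Type*} [NormedAddCommGroup F] [NormedSpace ℝ F]
    [SecondCountableTopologyEither (UnitAddTorus (Fin n)) F]
    (f : C(UnitAddTorus (Fin n), F)) : Integrable (fun x => f x) :=
  (map_continuous f).integrable_of_hasCompactSupport (HasCompactSupport.of_compactSpace _)

lemma integral_dist {n : ℕ} (f g : C(UnitAddTorus (Fin n), ℂ)) :
    ‖(∫ x, f x) - ∫ x, g x‖ ≤ ‖f - g‖ := by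
  rw [← integral_sub (torus_integrable f) (torus_integrable g)]
  have := norm_integral_le_of_norm_le_const (μ := (volume : Measure (UnitAddTorus (Fin n))))
    (f := fun x => f x - g x) (C := ‖f - g‖)
    (Eventually.of_forall fun x => (f - g).norm_coe_le_norm x)
  simpa using this

lemma weyl_mFourier {n : ℕ} (α : Fin n → ℝ)
    (hind : ∀ (q : ℚ) (c : Fin n → ℚ), (q : ℝ) + ∑ i, (c i : ℝ) * α i = 0 →
      q = 0 ∧ ∀ i, c i = 0) (k : Fin n → ℤ) :
    Tendsto (fun L => orbAv α L (UnitAddTorus.mFourier k)) atTop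
      (nhds (∫ x, UnitAddTorus.mFourier k x)) := by
  by_cases hk : k = 0
  · subst hk
    rw [UnitAddTorus.mFourier_zero]
    simp only [ContinuousMap.one_apply, integral_const, probReal_univ, one_smul]
    refine tendsto_const_nhds.congr' ?_
    filter_upwards [eventually_gt_atTop 0] with L hL
    have : (L : ℂ) ≠ 0 := by exact_mod_cast hL.ne'
    simp [orbAv, this]
  · have hz := mFourier_orbA_ne α hind k hk
    rw [integral_mFourier_zero k _ hz]
    set z := UnitAddTorus.mFourier k (orbA α) with hzdef
    have hn : ‖z‖ = 1 := mFourier_norm_apply k _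
    have hpos : 0 < ‖z - 1‖ := norm_pos_iff.2 (sub_ne_zero.2 hz)
    refine squeeze_zero_norm (a := fun L : ℕ => (2 / ‖z - 1‖) * (L : ℝ)⁻¹) (fun L => ?_) ?_
    · simp only [orbAv, mFourier_nsmul_apply, ← hzdef]
      rw [geom_sum_eq hz, norm_mul, norm_inv, Complex.norm_natCast, norm_div, mul_comm]
      gcongr
      calc ‖z ^ L - 1‖ ≤ ‖z ^ L‖ + ‖(1 : ℂ)‖ := norm_sub_le _ _
        _ = 2 := by rw [norm_pow, hn]; norm_num
    · simpa using (tendsto_inv_atTop_nhds_zero_nat (𝕜 := ℝ)).const_mul (2 / ‖z - 1‖)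

lemma weyl_all {n : ℕ} (α : Fin n → ℝ)
    (hind : ∀ (q : ℚ) (c : Fin n → ℚ), (q : ℝ) + ∑ i, (c i : ℝ) * α i = 0 →
      q = 0 ∧ ∀ i, c i = 0) (f : C(UnitAddTorus (Fin n), ℂ)) :
    Tendsto (fun L => orbAv α L f) atTop (nhds (∫ x, f x)) := by
  have hspan : ∀ g ∈ Submodule.span ℂ (Set.range (UnitAddTorus.mFourier (d := Fin n))),
      Tendsto (fun L => orbAv α L g) atTop (nhds (∫ x, g x)) := by
    intro g hg
    induction hg using Submodule.span_induction with
    | mem g hg => obtain ⟨k, rfl⟩ := hg; exact weyl_mFourier α hind k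
    | zero => simp [orbAv]
    | add g h _ _ hg hh =>
      have := hg.add hh
      rw [← integral_add (torus_integrable g) (torus_integrable h)] at this
      refine this.congr fun L => ?_
      simp [orbAv, Finset.sum_add_distrib, mul_add]
    | smul c g _ hg =>
      have := hg.const_mul c
      rw [← integral_const_mul] at this
      refine this.congr fun L => ?_
      simp [orbAv, ← Finset.mul_sum, mul_left_comm]
  have hf : f ∈ (Submodule.span ℂ
      (Set.range (UnitAddTorus.mFourier (d := Fin n)))).topologicalClosure := by
    rw [UnitAddTorus.span_mFourier_closure_eq_top]; trivial
  rw [← SetLike.mem_coe, Submodule.topologicalClosure_coe, Metric.mem_closure_iff] at hf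
  rw [Metric.tendsto_atTop]
  intro δ hδ
  obtain ⟨g, hg, hfg⟩ := hf (δ / 3) (by linarith)
  obtain ⟨L0, h0⟩ := Metric.tendsto_atTop.1 (hspan g hg) (δ / 3) (by linarith)
  refine ⟨L0, fun L hL => ?_⟩
  have a1 := orbAv_dist α L f g
  have a2 := integral_dist g f
  have a3 := h0 L hL
  rw [dist_eq_norm] at hfg a3 ⊢
  rw [norm_sub_rev g f] at a2
  calc ‖orbAv α L f - ∫ x, f x‖
      = ‖(orbAv α L f - orbAv α L g) + (orbAv α L g - ∫ x, g x) + ((∫ x, g x) - ∫ x, f x)‖ := by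
        congr 1; ring
    _ ≤ _ := norm_add₃_le
    _ < δ := by linarith

lemma weyl_real {n : ℕ} (α : Fin n → ℝ)
    (hind : ∀ (q : ℚ) (c : Fin n → ℚ), (q : ℝ) + ∑ i, (c i : ℝ) * α i = 0 →
      q = 0 ∧ ∀ i, c i = 0) (f : C(UnitAddTorus (Fin n), ℝ)) :
    Tendsto (fun L : ℕ => (L : ℝ)⁻¹ * ∑ y ∈ Finset.range L, f (y • orbA α)) atTop
      (nhds (∫ x, f x)) := by
  have h := weyl_all α hind ⟨fun x => (f x : ℂ), by fun_prop⟩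
  have h2 := (Complex.continuous_re.tendsto _).comp h
  have e : (∫ x, (⟨fun x => (f x : ℂ), by fun_prop⟩ : C(UnitAddTorus (Fin n), ℂ)) x).re
      = ∫ x, f x := by
    simp only [ContinuousMap.coe_mk]
    rw [integral_complex_ofReal]; simp
  rw [e] at h2
  refine h2.congr fun L => ?_
  simp only [orbAv, Function.comp, ContinuousMap.coe_mk]
  rw [← Complex.ofReal_sum, ← Complex.ofReal_natCast, ← Complex.ofReal_inv, ← Complex.ofReal_mul,
    Complex.ofReal_re]

/-- lower bound for the density of return times to an open set -/
lemma upDens_ge {n : ℕ} (α : Fin n → ℝ)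
    (hind : ∀ (q : ℚ) (c : Fin n → ℚ), (q : ℝ) + ∑ i, (c i : ℝ) * α i = 0 →
      q = 0 ∧ ∀ i, c i = 0) (U : Set (UnitAddTorus (Fin n))) (hU : IsOpen U) (A : Set ℤ)
    (hA : ∀ y : ℕ, y • orbA α ∈ U → (y : ℤ) ∈ A) :
    (volume U).toReal ≤ upDens (((↑) : ℤ → ℝ) '' A) := by
  classical
  refine le_of_forall_lt fun c hc => ?_
  rcases lt_or_ge c 0 with hc0 | hc0
  · exact hc0.trans_le (upDens_nonneg' A)
  obtain ⟨c', hcc', hc'⟩ := exists_between hc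
  obtain ⟨c'', hcc'', hc''⟩ := exists_between hcc'
  have hlt : ENNReal.ofReal c' < volume U := by
    rw [ENNReal.ofReal_lt_iff_lt_toReal (by linarith) (measure_ne_top _ _)]; exact hc'
  obtain ⟨Q, hQU, hQ, hQc⟩ := hU.exists_lt_isCompact hlt
  obtain ⟨f, f0, f1, f01⟩ := exists_continuous_zero_one_of_isClosed hU.isClosed_compl hQ.isClosed
    (Set.disjoint_left.2 fun x hx hx' => hx (hQU hx'))
  have hint : c' ≤ ∫ x, f x := by
    rw [ENNReal.ofReal_lt_iff_lt_toReal (by linarith) (measure_ne_top _ _)] at hQc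
    calc c' ≤ (volume Q).toReal := hQc.le
      _ = ∫ x, Q.indicator (fun _ => (1 : ℝ)) x := by
        rw [integral_indicator_const _ hQ.measurableSet]; simp [Measure.real]
      _ ≤ ∫ x, f x := by
        refine integral_mono ((integrable_const _).indicator hQ.measurableSet)
          (torus_integrable f) fun x => ?_
        by_cases hx : x ∈ Q
        · simp [hx, f1 hx]
        · simpa [hx] using (f01 x).1
  have ev := (weyl_real α hind f).eventually (lt_mem_nhds (hc''.trans_le hint))
  have key : ∀ᶠ L : ℕ in atTop, c'' ≤ densR (((↑) : ℤ → ℝ) '' A) ((L : ℝ) / 2) := by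
    filter_upwards [ev, eventually_ge_atTop 2] with L hL hL2
    have hL2' : (2 : ℝ) ≤ L := by exact_mod_cast hL2
    refine hL.le.trans ?_
    refine le_trans ?_ (le_densR A ((L : ℝ) / 2 - 1 / 2) (R := (L : ℝ) / 2) (by linarith))
    rw [inv_mul_eq_div, mul_div_cancel₀ _ (two_ne_zero)]
    gcongr
    calc ∑ y ∈ Finset.range L, f (y • orbA α)
        ≤ ∑ y ∈ Finset.range L, (if (y : ℤ) ∈ A then (1 : ℝ) else 0) := by
          refine Finset.sum_le_sum fun y _ => ?_
          split_ifs with h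
          · exact (f01 _).2
          · exact (f0 fun h' => h (hA y h')).le
      _ = (((Finset.range L).filter (fun y : ℕ => (y : ℤ) ∈ A)).card : ℝ) := Finset.sum_boole _ _
      _ ≤ _ := by
        norm_cast
        refine Finset.card_le_card_of_injOn (fun y : ℕ => (y : ℤ)) ?_ ?_
        · intro y hy
          simp only [Finset.coe_filter, Finset.mem_range, mem_ibB, Real.ball_eq_Ioo, Set.mem_Ioo,
            Set.mem_ofPred_eq] at hy ⊢
          have : (y : ℝ) + 1 ≤ L := by exact_mod_cast hy.1
          have : (0 : ℝ) ≤ y := by positivity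
          push_cast
          exact ⟨⟨by linarith, by linarith⟩, hy.2⟩
        · intro a _ b _ h
          simpa using h
  have hfreq : ∃ᶠ R : ℝ in atTop, c'' ≤ densR (((↑) : ℤ → ℝ) '' A) R := by
    have ht : Tendsto (fun L : ℕ => (L : ℝ) / 2) atTop atTop :=
      tendsto_natCast_atTop_atTop.atTop_div_const (by norm_num)
    exact ht.frequently key.frequently
  exact hcc''.trans_le (le_limsup_of_frequently_le hfreq (densR_bdd A))

/-- projection to the torus -/
noncomputable def torPi {n : ℕ} (x : Fin n → ℝ) : UnitAddTorus (Fin n) :=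
  fun i => ((x i : ℝ) : UnitAddCircle)

lemma torPi_eq {n : ℕ} (x y : Fin n → ℝ) (h : torPi x = torPi y) :
    ∃ m : Fin n → ℤ, x - y = fun i => (m i : ℝ) := by
  have : ∀ i, ∃ m : ℤ, x i - y i = m := by
    intro i
    have h1 : ((x i : ℝ) : UnitAddCircle) = ((y i : ℝ) : UnitAddCircle) := congrFun h i
    rw [eq_comm, QuotientAddGroup.eq, AddSubgroup.mem_zmultiples_iff] at h1
    obtain ⟨m, hm⟩ := h1
    refine ⟨m, ?_⟩
    simp at hm
    linarith
  choose m hm using this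
  exact ⟨m, funext hm⟩

lemma torPi_add_int {n : ℕ} (x : Fin n → ℝ) (m : Fin n → ℤ) :
    torPi (x + fun i => (m i : ℝ)) = torPi x := by
  funext i
  change (((x i + m i : ℝ)) : UnitAddCircle) = ((x i : ℝ) : UnitAddCircle)
  rw [eq_comm, QuotientAddGroup.eq, AddSubgroup.mem_zmultiples_iff]
  exact ⟨m i, by simp⟩

lemma torPi_open {n : ℕ} : IsOpenMap (torPi (n := n)) :=
  IsOpenMap.piMap (f := fun (_ : Fin n) (x : ℝ) => (x : UnitAddCircle))
    (fun _ => QuotientAddGroup.isOpenMap_coe) (Filter.Eventually.of_forall fun i =>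
      QuotientAddGroup.mk_surjective)

lemma torPi_mp {n : ℕ} : MeasurePreserving (torPi (n := n))
    (volume.restrict (Set.univ.pi fun _ => Set.Ioc (0 : ℝ) (0 + 1))) volume := by
  have := measurePreserving_pi (fun _ : Fin n => (volume : Measure ℝ).restrict (Set.Ioc 0 (0 + 1)))
    (fun _ : Fin n => (volume : Measure UnitAddCircle))
    (fun i => UnitAddCircle.measurePreserving_mk 0)
  rw [← Measure.restrict_pi_pi] at this
  exact this

lemma vol_le_torus {n : ℕ} (W : Set (Fin n → ℝ)) (hW : IsOpen W)
    (hdis : ∀ m : Fin n → ℤ, m ≠ 0 → ∀ x ∈ W, (x - fun i => (m i : ℝ)) ∉ W) :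
    volume W ≤ volume (torPi '' W) := by
  set C : Set (Fin n → ℝ) := Set.univ.pi fun _ => Set.Ioc (0 : ℝ) (0 + 1) with hC
  have hCm : MeasurableSet C := MeasurableSet.univ_pi fun _ => measurableSet_Ioc
  have hWT : MeasurableSet (torPi '' W) := (torPi_open W hW).measurableSet
  let V : (Fin n → ℤ) → Set (Fin n → ℝ) := fun m =>
    (fun x : Fin n → ℝ => x + fun i => (m i : ℝ)) ⁻¹' W ∩ C
  have hVm : ∀ m, MeasurableSet (V m) := fun m =>
    ((measurable_id.add_const _) hW.measurableSet).inter hCm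
  rw [← torPi_mp.measure_preimage hWT.nullMeasurableSet,
    Measure.restrict_apply (torPi_mp.measurable hWT)]
  have hsub : (⋃ m, V m) ⊆ torPi ⁻¹' (torPi '' W) ∩ C := by
    intro x hx
    obtain ⟨m, hm, hxC⟩ := Set.mem_iUnion.1 hx
    exact ⟨⟨_, hm, torPi_add_int x m⟩, hxC⟩
  refine le_trans ?_ (measure_mono hsub)
  rw [measure_iUnion ?_ hVm]
  · have hcov : W ⊆ ⋃ m : Fin n → ℤ, (fun x : Fin n → ℝ => x + fun i => -(m i : ℝ)) ⁻¹' (V m) := by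
      intro x hx
      refine Set.mem_iUnion.2 ⟨fun i => ⌈x i⌉ - 1, ?_, ?_⟩
      · rw [Set.mem_preimage]
        have : (x + fun i => -((⌈x i⌉ - 1 : ℤ) : ℝ)) + (fun i => ((⌈x i⌉ - 1 : ℤ) : ℝ)) = x := by
          funext i
          simp
          ring
        exact this.symm ▸ hx
      · intro i _
        have h1 := Int.le_ceil (x i)
        have h2 := Int.ceil_lt_add_one (x i)
        constructor <;> simp <;> linarith
    refine (measure_mono hcov).trans ((measure_iUnion_le _).trans ?_)
    refine ENNReal.tsum_le_tsum fun m => ?_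
    rw [measure_preimage_add_right]
  · intro m m' hmm
    refine Set.disjoint_left.2 ?_
    rintro x ⟨hx, _⟩ ⟨hx', _⟩
    refine hdis (m - m') (sub_ne_zero.2 hmm) _ hx ?_
    have : ((x + fun i => (m i : ℝ)) - fun i => (((m - m') i : ℤ) : ℝ)) =
        x + fun i => (m' i : ℝ) := by
      funext i
      simp
      ring
    exact this.symm ▸ hx'

lemma norm_cont {n : ℕ} (N : (Fin n → ℝ) → ℝ)
    (hadd : ∀ x y, N (x + y) ≤ N x + N y)
    (hsmul : ∀ (c : ℝ) x, N (c • x) = |c| * N x) : Continuous N := by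
  have : ConvexOn ℝ Set.univ N := by
    refine ⟨convex_univ, fun x _ y _ a b ha hb _ => ?_⟩
    refine (hadd _ _).trans ?_
    rw [hsmul, hsmul, abs_of_nonneg ha, abs_of_nonneg hb]
    rfl
  exact this.locallyLipschitz.continuous

/-- for a badly-overlapping window, the frequencies of differences
in the approximation set E satisfy ∑_{|u|≤d} ρ_E(u) ≥ d·Vol(W). -/
theorem approx_set_freq_bound {n : ℕ} (N : (Fin n → ℝ) → ℝ)
    (hadd : ∀ x y, N (x + y) ≤ N x + N y)
    (hsmul : ∀ (c : ℝ) x, N (c • x) = |c| * N x)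
    (hpos : ∀ x, x ≠ 0 → 0 < N x)
    (ε : ℝ) (hε : 0 < ε) (α : Fin n → ℝ)
    (hind : ∀ (q : ℚ) (c : Fin n → ℚ), (q : ℝ) + ∑ i, (c i : ℝ) * α i = 0 →
      q = 0 ∧ ∀ i, c i = 0)
    (hwindow : ∀ m : Fin n → ℤ, m ≠ 0 →
      {x : Fin n → ℝ | N x < ε} ∩
        {x : Fin n → ℝ | N (x - fun i => (m i : ℝ)) < ε} = ∅) :
    ∀ d > (0 : ℝ),
      d * (volume {x : Fin n → ℝ | N x < ε}).toReal
        ≤ ∑' u : {u : ℝ // (∃ m : ℤ, u = (m : ℝ)) ∧ |u| ≤ d},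
            freq {t : ℝ | ∃ y : ℤ, t = (y : ℝ) ∧ ∃ x : Fin n → ℤ,
              N ((fun i => (y : ℝ) * α i) - fun i => (x i : ℝ)) < ε} (u : ℝ) := by
  intro d hd
  set W : Set (Fin n → ℝ) := {x : Fin n → ℝ | N x < ε} with hWdef
  have hW : IsOpen W := isOpen_lt (norm_cont N hadd hsmul) continuous_const
  have hdis : ∀ m : Fin n → ℤ, m ≠ 0 → ∀ x ∈ W, (x - fun i => (m i : ℝ)) ∉ W := by
    intro m hm x hx hx'
    have := hwindow m hm
    exact (Set.eq_empty_iff_forall_notMem.1 this x) ⟨hx, hx'⟩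
  set A : Set ℤ := {y : ℤ | ∃ x : Fin n → ℤ,
    N ((fun i => (y : ℝ) * α i) - fun i => (x i : ℝ)) < ε} with hA
  have hE : {t : ℝ | ∃ y : ℤ, t = (y : ℝ) ∧ ∃ x : Fin n → ℤ,
      N ((fun i => (y : ℝ) * α i) - fun i => (x i : ℝ)) < ε} = ((↑) : ℤ → ℝ) '' A := by
    ext t
    constructor
    · rintro ⟨y, rfl, hy⟩
      exact ⟨y, hy, rfl⟩
    · rintro ⟨y, hy, rfl⟩
      exact ⟨y, rfl, hy⟩
  rw [hE]
  have hsh : ∀ u : ℤ, {x ∈ ((↑) : ℤ → ℝ) '' A | x + (u : ℝ) ∈ ((↑) : ℤ → ℝ) '' A}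
      = ((↑) : ℤ → ℝ) '' (shA A u) := by
    intro u
    ext t
    constructor
    · rintro ⟨⟨a, ha, rfl⟩, b, hb, hab⟩
      refine ⟨a, ⟨ha, ?_⟩, rfl⟩
      have : b = a + u := by exact_mod_cast hab
      exact this ▸ hb
    · rintro ⟨a, ⟨ha, hb⟩, rfl⟩
      exact ⟨⟨a, ha, rfl⟩, a + u, hb, by push_cast; rfl⟩
  have hfreq : ∀ u : ℤ, freq (((↑) : ℤ → ℝ) '' A) (u : ℝ)
      = upDens (((↑) : ℤ → ℝ) '' (shA A u)) / upDens (((↑) : ℤ → ℝ) '' A) := by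
    intro u
    rw [freq, hsh]
  -- rewrite the sum
  set K : ℕ := ⌊d⌋₊ + 1 with hK
  have hdK : d ≤ K := by
    rw [hK]; push_cast; exact (Nat.lt_floor_add_one d).le
  have hmemK : ∀ m : ℤ, m ∈ Finset.Ioo (-(K : ℤ)) K ↔ |(m : ℝ)| ≤ d := by
    intro m
    have h1 : |(m : ℝ)| = ((m.natAbs : ℕ) : ℝ) := by
      rw [Nat.cast_natAbs]; push_cast; rfl
    rw [h1, ← Nat.le_floor_iff hd.le, Finset.mem_Ioo]
    omega
  have hsum : ∑' u : {u : ℝ // (∃ m : ℤ, u = (m : ℝ)) ∧ |u| ≤ d},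
      freq (((↑) : ℤ → ℝ) '' A) (u : ℝ)
      = ∑ u ∈ Finset.Ioo (-(K : ℤ)) K, freq (((↑) : ℤ → ℝ) '' A) (u : ℝ) := by
    let e : {m : ℤ // m ∈ Finset.Ioo (-(K : ℤ)) K} ≃
        {u : ℝ // (∃ m : ℤ, u = (m : ℝ)) ∧ |u| ≤ d} :=
      Equiv.ofBijective (fun m => ⟨(m.1 : ℝ), ⟨m.1, rfl⟩, (hmemK m.1).1 m.2⟩) (by
        constructor
        · intro a b h
          have : (a.1 : ℝ) = b.1 := congrArg Subtype.val h
          exact Subtype.ext (by exact_mod_cast this)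
        · rintro ⟨_, ⟨m, rfl⟩, hm⟩
          exact ⟨⟨m, (hmemK m).2 hm⟩, rfl⟩)
    rw [← e.tsum_eq]
    exact Finset.tsum_subtype (Finset.Ioo (-(K : ℤ)) K)
      (fun u : ℤ => freq (((↑) : ℤ → ℝ) '' A) (u : ℝ))
  rw [hsum]
  simp only [hfreq]
  have hAU : ∀ y : ℕ, y • orbA α ∈ torPi '' W → (y : ℤ) ∈ A := by
    rintro y ⟨w, hw, hwy⟩
    have h1 : y • orbA α = torPi (fun i => (y : ℝ) * α i) := by
      funext i
      simp only [orbA, torPi, Pi.smul_apply]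
      rw [← nsmul_eq_mul, AddCircle.coe_nsmul]
    rw [h1] at hwy
    obtain ⟨m, hm⟩ := torPi_eq _ _ hwy.symm
    refine ⟨m, ?_⟩
    have h2 : ((fun i => (((y : ℕ) : ℤ) : ℝ) * α i) - fun i => (m i : ℝ)) = w := by
      rw [← hm]; push_cast; abel
    rw [h2]; exact hw
  have hvol : (volume W).toReal ≤ upDens (((↑) : ℤ → ℝ) '' A) :=
    (ENNReal.toReal_mono (measure_ne_top _ _) (vol_le_torus W hW hdis)).trans
      (upDens_ge α hind _ (torPi_open W hW) A hAU)
  rcases (upDens_nonneg' A).eq_or_lt with h0 | h0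
  · have : (volume W).toReal = 0 := le_antisymm (hvol.trans h0.symm.le) ENNReal.toReal_nonneg
    rw [this, mul_zero]
    exact Finset.sum_nonneg fun u _ => div_nonneg (upDens_nonneg' _) (upDens_nonneg' _)
  · refine le_trans ?_ (upDens_final A K (by omega) h0)
    exact mul_le_mul hdK hvol ENNReal.toReal_nonneg (by positivity)
end

section
/- Let Γ ⊂ ℝⁿ be a Delone set and (A_k) a sequence of invertible linear maps with |det(A₁⋯A_k)| = 1 for all k. If the set Γ_k = (Â_k ∘ ⋯ ∘ Â₁)(ℤⁿ) is weakly almost periodic, then the rate of injectivity τᵏ(A₁,…,A_k) = lim_{R→∞} #((Â_k∘⋯∘Â₁)(B_R ∩ ℤⁿ))/#(B_R ∩ ℤⁿ) exists and equals D(Γ_k), the uniform density of Γ_k. -/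
open Filter MeasureTheory Metric Pointwise

variable {E : Type*} [NormedAddCommGroup E] [MeasureSpace E]

/-- k-fold composition f_{k-1} ∘ ⋯ ∘ f_0. -/
def iterComp {α : Type*} (f : ℕ → α → α) : ℕ → α → α
  | 0 => id
  | (k + 1) => f k ∘ iterComp f k


abbrev Zn (n : ℕ) : Set (EuclideanSpace ℝ (Fin n)) := {x | ∀ i : Fin n, ∃ m : ℤ, x i = (m : ℝ)}

noncomputable abbrev vB (n : ℕ) (R : ℝ) : ℝ := (volume (ball (0 : EuclideanSpace ℝ (Fin n)) R)).toReal

lemma Zn_finite {n : ℕ} (p : EuclideanSpace ℝ (Fin n)) (R : ℝ) : (Zn n ∩ ball p R).Finite := by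
  have h : (Set.Icc (fun i => ⌊p i - R⌋) (fun i => ⌈p i + R⌉) : Set (Fin n → ℤ)).Finite :=
    Set.finite_Icc _ _
  refine (h.image (fun m => WithLp.toLp 2 (fun i => (m i : ℝ)))).subset ?_
  rintro x ⟨hx, hb⟩
  choose m hm using hx
  refine ⟨m, ?_, ?_⟩
  · have key : ∀ i, |x i - p i| < R := by
      intro i
      have h1 : ‖(x - p) i‖ ≤ ‖x - p‖ := PiLp.norm_apply_le _ _
      have h2 : ‖x - p‖ < R := by simpa [dist_eq_norm] using hb
      simpa using lt_of_le_of_lt h1 h2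
    refine ⟨fun i => ?_, fun i => ?_⟩
    · have := abs_lt.1 (key i)
      have h3 : (⌊p i - R⌋ : ℝ) ≤ m i := by
        rw [← hm i]; exact (Int.floor_le _).trans (by linarith)
      exact_mod_cast h3
    · have := abs_lt.1 (key i)
      have h3 : (m i : ℝ) ≤ ⌈p i + R⌉ := by
        rw [← hm i]; exact le_trans (by linarith) (Int.le_ceil _)
      exact_mod_cast h3
  · ext i; simp [hm]

lemma vB_pos {n : ℕ} {R : ℝ} (hR : 0 < R) : 0 < vB n R :=
  ENNReal.toReal_pos (measure_ball_pos _ _ hR).ne' measure_ball_lt_top.ne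

lemma vB_eq {n : ℕ} {R : ℝ} (hR : 0 < R) : vB n R = R ^ n * vB n 1 := by
  unfold vB
  rw [Measure.addHaar_ball_of_pos _ _ hR, ENNReal.toReal_mul, ENNReal.toReal_ofReal (by positivity)]
  simp

lemma vol_ball_center {n : ℕ} (p : EuclideanSpace ℝ (Fin n)) (R : ℝ) :
    (volume (ball p R)).toReal = vB n R := by
  rw [Measure.addHaar_ball_center]

lemma vB_ratio {n : ℕ} (c : ℝ) : Tendsto (fun R => vB n (R + c) / vB n R) atTop (nhds 1) := by
  have h : Tendsto (fun R : ℝ => (1 + c / R) ^ n) atTop (nhds 1) := by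
    have : Tendsto (fun R : ℝ => c / R) atTop (nhds 0) := tendsto_const_nhds.div_atTop tendsto_id
    simpa using (this.const_add 1).pow n
  refine h.congr' ?_
  filter_upwards [eventually_gt_atTop 0, eventually_gt_atTop (-c)] with R h1 h2
  rw [vB_eq h1, vB_eq (by linarith : 0 < R + c)]
  have := vB_pos (n := n) (R := 1) one_pos
  rw [mul_div_mul_right _ _ this.ne', ← div_pow]
  congr 1
  field_simp

lemma vol_preim {n : ℕ} (M : EuclideanSpace ℝ (Fin n) →ₗ[ℝ] EuclideanSpace ℝ (Fin n))
    (hM : |LinearMap.det M| = 1) (p : EuclideanSpace ℝ (Fin n)) (R : ℝ) :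
    volume (M ⁻¹' ball p R) = volume (ball (0 : EuclideanSpace ℝ (Fin n)) R) := by
  have h0 : LinearMap.det M ≠ 0 := by intro h; simp [h] at hM
  rw [Measure.addHaar_preimage_linearMap _ h0, abs_inv, hM]
  simp [Measure.addHaar_ball_center]

lemma preim_meas {n : ℕ} (M : EuclideanSpace ℝ (Fin n) →ₗ[ℝ] EuclideanSpace ℝ (Fin n))
    (p : EuclideanSpace ℝ (Fin n)) (R : ℝ) : MeasurableSet (M ⁻¹' ball p R) :=
  (isOpen_ball.preimage M.continuous_of_finiteDimensional).measurableSet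

/-- double counting -/
lemma dc {n : ℕ} (F : Finset (EuclideanSpace ℝ (Fin n))) (K S : Set (EuclideanSpace ℝ (Fin n)))
    (hK : MeasurableSet K) :
    ∫⁻ x in S, ((((F : Set (EuclideanSpace ℝ (Fin n))) ∩ {γ | x - γ ∈ K}).ncard : ℕ) : ENNReal)
      = ∑ γ ∈ F, volume ({x | x - γ ∈ K} ∩ S) := by
  classical
  have hm : ∀ γ : EuclideanSpace ℝ (Fin n), MeasurableSet {x | x - γ ∈ K} := fun γ =>
    (measurable_id.sub_const γ) hK
  have : ∀ x, ((((F : Set (EuclideanSpace ℝ (Fin n))) ∩ {γ | x - γ ∈ K}).ncard : ℕ) : ENNReal)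
      = ∑ γ ∈ F, Set.indicator {x | x - γ ∈ K} 1 x := by
    intro x
    have e : ((F : Set (EuclideanSpace ℝ (Fin n))) ∩ {γ | x - γ ∈ K}) = 
        ((F.filter (fun γ => x - γ ∈ K) : Finset _) : Set (EuclideanSpace ℝ (Fin n))) := by
      ext; simp
    rw [e, Set.ncard_coe_finset, Finset.card_filter]
    push_cast
    refine Finset.sum_congr rfl fun γ _ => ?_
    simp [Set.indicator_apply]
  simp_rw [this]
  rw [lintegral_finsetSum]
  · refine Finset.sum_congr rfl fun γ _ => ?_
    rw [lintegral_indicator_one (hm γ), Measure.restrict_apply (hm γ)]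
  · intro γ _
    exact measurable_one.indicator (hm γ)

lemma vol_trans {n : ℕ} (K : Set (EuclideanSpace ℝ (Fin n))) (γ : EuclideanSpace ℝ (Fin n)) :
    volume {x | x - γ ∈ K} = volume K := by
  have := measure_preimage_add_right (volume : Measure (EuclideanSpace ℝ (Fin n))) (-γ) K
  simpa [sub_eq_add_neg, Set.preimage] using this

lemma finM {n : ℕ} {Γ : Set (EuclideanSpace ℝ (Fin n))} (hΓ : Γ ⊆ Zn n)
    (M : EuclideanSpace ℝ (Fin n) →ₗ[ℝ] EuclideanSpace ℝ (Fin n))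
    (hM : |LinearMap.det M| = 1) (p : EuclideanSpace ℝ (Fin n)) (R : ℝ) :
    (Γ ∩ M ⁻¹' ball p R).Finite := by
  have h0 : LinearMap.det M ≠ 0 := by intro h; simp [h] at hM
  let e := LinearMap.equivOfDetNeZero M h0
  let e' := e.toContinuousLinearEquiv
  have hb : Bornology.IsBounded (M ⁻¹' ball p R) := by
    have : M ⁻¹' ball p R = e'.symm '' ball p R := by
      ext x
      constructor
      · intro h
        exact ⟨e' x, h, by simp⟩
      · rintro ⟨y, hy, rfl⟩
        have : e' (e'.symm y) = y := by simp
        change e' (e'.symm y) ∈ ball p R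
        rwa [this]
    rw [this]
    exact e'.symm.lipschitz.isBounded_image isBounded_ball
  obtain ⟨r, hr⟩ := hb.subset_ball 0
  exact (Zn_finite 0 r).subset (Set.inter_subset_inter hΓ hr)

lemma count_upper {n : ℕ} {Γ : Set (EuclideanSpace ℝ (Fin n))} (hΓ : Γ ⊆ Zn n)
    (M : EuclideanSpace ℝ (Fin n) →ₗ[ℝ] EuclideanSpace ℝ (Fin n))
    (hM : |LinearMap.det M| = 1) {K : Set (EuclideanSpace ℝ (Fin n))} (hK : MeasurableSet K)
    {r c : ℝ} (hKr : K ⊆ ball 0 r) (hKc : ∀ z ∈ K, ‖M z‖ ≤ c) {b : ℝ}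
    (hb : ∀ x, ((Γ ∩ {γ | x - γ ∈ K}).ncard : ℝ) ≤ b) (p : EuclideanSpace ℝ (Fin n)) (R : ℝ) :
    ((Γ ∩ M ⁻¹' ball p R).ncard : ℝ) * (volume K).toReal ≤ b * vB n (R + c) := by
  have hfin := finM hΓ M hM p R
  have hb0 : 0 ≤ b := le_trans (by positivity) (hb 0)
  have h := dc hfin.toFinset K (M ⁻¹' ball p (R + c)) hK
  have h1 : ∑ γ ∈ hfin.toFinset, volume ({x | x - γ ∈ K} ∩ M ⁻¹' ball p (R + c))
      = ((Γ ∩ M ⁻¹' ball p R).ncard : ENNReal) * volume K := by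
    rw [Set.ncard_eq_toFinset_card _ hfin, ← nsmul_eq_mul, ← Finset.sum_const]
    refine Finset.sum_congr rfl fun γ hγ => ?_
    rw [← vol_trans K γ]
    congr 1
    refine Set.inter_eq_left.2 fun x hx => ?_
    have hγ : M γ ∈ ball p R := by simp at hγ; simpa using hγ.2
    have h2 := hKc _ hx
    rw [mem_ball, dist_eq_norm] at hγ
    simp only [Set.mem_preimage, mem_ball, dist_eq_norm]
    have : M x - p = (M γ - p) + M (x - γ) := by rw [map_sub]; abel
    rw [this]
    exact lt_of_le_of_lt (norm_add_le _ _) (by linarith)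
  have h2 : ∫⁻ x in M ⁻¹' ball p (R + c), ((((hfin.toFinset : Set (EuclideanSpace ℝ (Fin n))) ∩ {γ | x - γ ∈ K}).ncard : ℕ) : ENNReal) ≤ ENNReal.ofReal b * volume (ball (0 : EuclideanSpace ℝ (Fin n)) (R + c)) := by
    rw [← vol_preim M hM p, ← setLIntegral_const]
    refine lintegral_mono fun x => ?_
    rw [← ENNReal.ofReal_natCast]
    refine ENNReal.ofReal_le_ofReal (le_trans ?_ (hb x))
    have hf2 : (Γ ∩ {γ | x - γ ∈ K}).Finite := by
      refine (Zn_finite x r).subset (Set.inter_subset_inter hΓ ?_)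
      intro γ hγ
      have := hKr hγ
      simpa [dist_eq_norm, norm_sub_rev] using this
    refine Nat.cast_le.2 (Set.ncard_le_ncard ?_ hf2)
    refine Set.inter_subset_inter_left _ ?_
    simp
  rw [h, h1] at h2
  have h3 := ENNReal.toReal_mono (ENNReal.mul_ne_top ENNReal.ofReal_ne_top measure_ball_lt_top.ne) h2
  simpa [ENNReal.toReal_mul, hb0] using h3

lemma count_lower {n : ℕ} {Γ : Set (EuclideanSpace ℝ (Fin n))} (hΓ : Γ ⊆ Zn n)
    (M : EuclideanSpace ℝ (Fin n) →ₗ[ℝ] EuclideanSpace ℝ (Fin n))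
    (hM : |LinearMap.det M| = 1) {K : Set (EuclideanSpace ℝ (Fin n))} (hK : MeasurableSet K)
    {r c : ℝ} (hKr : K ⊆ ball 0 r) (hKc : ∀ z ∈ K, ‖M z‖ ≤ c) {b : ℝ}
    (hb : ∀ x, b ≤ ((Γ ∩ {γ | x - γ ∈ K}).ncard : ℝ)) (p : EuclideanSpace ℝ (Fin n)) (R : ℝ) :
    b * vB n (R - c) ≤ ((Γ ∩ M ⁻¹' ball p R).ncard : ℝ) * (volume K).toReal := by
  rcases le_total b 0 with hb0 | hb0
  · exact le_trans (mul_nonpos_of_nonpos_of_nonneg hb0 ENNReal.toReal_nonneg) (by positivity)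
  have hfin := finM hΓ M hM p R
  have h := dc hfin.toFinset K (M ⁻¹' ball p (R - c)) hK
  have h1 : ∑ γ ∈ hfin.toFinset, volume ({x | x - γ ∈ K} ∩ M ⁻¹' ball p (R - c))
      ≤ ((Γ ∩ M ⁻¹' ball p R).ncard : ENNReal) * volume K := by
    rw [Set.ncard_eq_toFinset_card _ hfin, ← nsmul_eq_mul, ← Finset.sum_const]
    refine Finset.sum_le_sum fun γ hγ => ?_
    rw [← vol_trans K γ]
    exact measure_mono Set.inter_subset_left
  have h2 : ENNReal.ofReal b * volume (ball (0 : EuclideanSpace ℝ (Fin n)) (R - c)) ≤ ∫⁻ x in M ⁻¹' ball p (R - c), ((((hfin.toFinset : Set (EuclideanSpace ℝ (Fin n))) ∩ {γ | x - γ ∈ K}).ncard : ℕ) : ENNReal) := by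
    rw [← vol_preim M hM p, ← setLIntegral_const]
    refine setLIntegral_mono' (preim_meas M p _) fun x hx => ?_
    rw [← ENNReal.ofReal_natCast]
    refine ENNReal.ofReal_le_ofReal ((hb x).trans ?_)
    refine Nat.cast_le.2 (Set.ncard_le_ncard ?_ (Set.Finite.inter_of_left (Finset.finite_toSet _) _))
    rintro γ ⟨hγ, hγK⟩
    refine ⟨?_, hγK⟩
    simp only [Set.Finite.coe_toFinset]
    refine ⟨hγ, ?_⟩
    have h2 := hKc _ hγK
    simp only [Set.mem_preimage, mem_ball, dist_eq_norm] at hx ⊢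
    have : M γ - p = (M x - p) - M (x - γ) := by rw [map_sub]; abel
    rw [this]
    exact lt_of_le_of_lt (norm_sub_le _ _) (by linarith)
  rw [h] at h2
  have hKt : volume K ≠ ⊤ := ((measure_mono hKr).trans_lt measure_ball_lt_top).ne
  have h3 := ENNReal.toReal_mono (ENNReal.mul_ne_top (ENNReal.natCast_ne_top _) hKt) (h2.trans h1)
  simpa [ENNReal.toReal_mul, hb0] using h3

lemma step {n : ℕ} {Γ : Set (EuclideanSpace ℝ (Fin n))} (hΓ : Γ ⊆ Zn n)
    (M : EuclideanSpace ℝ (Fin n) →ₗ[ℝ] EuclideanSpace ℝ (Fin n))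
    (hM : |LinearMap.det M| = 1) {K : Set (EuclideanSpace ℝ (Fin n))} (hK : MeasurableSet K)
    {r : ℝ} (hKr : K ⊆ ball 0 r) (hV : 0 < (volume K).toReal) {l u l' u' : ℝ}
    (hl : ∀ x, l * (volume K).toReal ≤ ((Γ ∩ {γ | x - γ ∈ K}).ncard : ℝ))
    (hu : ∀ x, ((Γ ∩ {γ | x - γ ∈ K}).ncard : ℝ) ≤ u * (volume K).toReal)
    (hl' : l' < l) (hu' : u < u') :
    ∀ᶠ R in atTop, ∀ p, l' ≤ ((Γ ∩ M ⁻¹' ball p R).ncard : ℝ) / vB n R ∧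
      ((Γ ∩ M ⁻¹' ball p R).ncard : ℝ) / vB n R ≤ u' := by
  let Mc := LinearMap.toContinuousLinearMap M
  have hKc : ∀ z ∈ K, ‖M z‖ ≤ ‖Mc‖ * r := by
    intro z hz
    have h1 : ‖z‖ < r := by simpa using hKr hz
    exact (Mc.le_opNorm z).trans (mul_le_mul_of_nonneg_left h1.le (norm_nonneg _))
  set c := ‖Mc‖ * r
  have t1 : Tendsto (fun R => u * (vB n (R + c) / vB n R)) atTop (nhds u) := by
    simpa using (vB_ratio (n := n) c).const_mul u
  have t2 : Tendsto (fun R => l * (vB n (R - c) / vB n R)) atTop (nhds l) := by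
    simpa [sub_eq_add_neg] using (vB_ratio (n := n) (-c)).const_mul l
  filter_upwards [t1.eventually_lt_const hu', t2.eventually_const_lt hl', eventually_gt_atTop 0]
    with R h1 h2 hR p
  have hv := vB_pos (n := n) hR
  have a := count_upper hΓ M hM hK hKr hKc hu p R
  have b := count_lower hΓ M hM hK hKr hKc hl p R
  rw [mul_right_comm] at a b
  have a := le_of_mul_le_mul_right a hV
  have b := le_of_mul_le_mul_right b hV
  constructor
  · refine h2.le.trans ?_
    rw [← mul_div_assoc]
    exact div_le_div_of_nonneg_right b hv.le
  · refine le_trans ?_ h1.le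
    rw [← mul_div_assoc]
    exact div_le_div_of_nonneg_right a hv.le

/-- WAP gives two-sided bounds -/
lemma wap_bounds {n : ℕ} {Γ : Set (EuclideanSpace ℝ (Fin n))} (hΓ : Γ ⊆ Zn n) (hw : WAP Γ)
    {ε : ℝ} (hε : 0 < ε) : ∃ a : ℝ, ∀ M : EuclideanSpace ℝ (Fin n) →ₗ[ℝ] EuclideanSpace ℝ (Fin n),
    |LinearMap.det M| = 1 → 
    ∀ᶠ R in atTop, ∀ p, a - ε ≤ ((Γ ∩ M ⁻¹' ball p R).ncard : ℝ) / vB n R ∧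
      ((Γ ∩ M ⁻¹' ball p R).ncard : ℝ) / vB n R ≤ a + ε := by
  obtain ⟨R, hR, h⟩ := hw.2 (ε / 2) (by positivity)
  have hv := vB_pos (n := n) hR
  have heq : ∀ x : EuclideanSpace ℝ (Fin n), {γ | x - γ ∈ ball (0 : EuclideanSpace ℝ (Fin n)) R} = ball x R := by
    intro x; ext γ; simp [dist_eq_norm, norm_sub_rev]
  have hfin : ∀ x, (Γ ∩ ball x R).Finite := fun x =>
    (Zn_finite x R).subset (Set.inter_subset_inter_left _ hΓ)
  have hsd : ∀ {s t : Set (EuclideanSpace ℝ (Fin n))}, s.Finite → t.Finite →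
      s.ncard ≤ t.ncard + (symmDiff s t).ncard := by
    intro s t hs ht
    refine le_trans (Set.ncard_le_ncard (t := t ∪ symmDiff s t) ?_ ?_) (Set.ncard_union_le _ _)
    · intro x hx
      by_cases hxt : x ∈ t
      · exact Or.inl hxt
      · exact Or.inr (Or.inl ⟨hx, hxt⟩)
    · exact ht.union ((hs.union ht).subset (by
        rintro x (hx | hx)
        · exact Or.inl hx.1
        · exact Or.inr hx.1))
  have key : ∀ x y, ((Γ ∩ ball x R).ncard : ℝ) ≤ (Γ ∩ ball y R).ncard + ε / 2 * vB n R := by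
    intro x y
    obtain ⟨v, hv⟩ := h x y
    have h1 := hsd (hfin x) ((hfin y).image (fun z => z - v))
    rw [Set.ncard_image_of_injective _ (sub_left_injective)] at h1
    have h1 := (Nat.cast_le (α := ℝ)).2 h1
    rw [Nat.cast_add] at h1
    linarith
  refine ⟨(Γ ∩ ball 0 R).ncard / vB n R, fun M hM => ?_⟩
  refine step hΓ M hM (measurableSet_ball (x := 0) (ε := R)) le_rfl hv
    (l := (Γ ∩ ball 0 R).ncard / vB n R - ε / 2) (u := (Γ ∩ ball 0 R).ncard / vB n R + ε / 2)
    ?_ ?_ (by linarith) (by linarith)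
  · intro x
    rw [heq, sub_mul, div_mul_cancel₀ _ hv.ne']
    have := key 0 x
    linarith
  · intro x
    rw [heq, add_mul, div_mul_cancel₀ _ hv.ne']
    exact key x 0

lemma wap_tendsto {n : ℕ} {Γ : Set (EuclideanSpace ℝ (Fin n))} (hΓ : Γ ⊆ Zn n) (hw : WAP Γ)
    (M : EuclideanSpace ℝ (Fin n) →ₗ[ℝ] EuclideanSpace ℝ (Fin n))
    (hM : |LinearMap.det M| = 1) :
    Tendsto (fun R => ((Γ ∩ M ⁻¹' ball 0 R).ncard : ℝ) / vB n R) atTop (nhds (upDens Γ)) := by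
  rw [Metric.tendsto_nhds]
  intro ε hε
  obtain ⟨a, ha⟩ := wap_bounds hΓ hw (ε := ε / 3) (by positivity)
  have hid := ha LinearMap.id (by simp)
  have hd : ∀ᶠ R in atTop, a - ε / 3 ≤ densR Γ R ∧ densR Γ R ≤ a + ε / 3 := by
    filter_upwards [hid] with R hR
    have hR : ∀ p, a - ε / 3 ≤ ((Γ ∩ ball p R).ncard : ℝ) / (volume (ball p R)).toReal ∧
        ((Γ ∩ ball p R).ncard : ℝ) / (volume (ball p R)).toReal ≤ a + ε / 3 := by
      intro p
      rw [vol_ball_center]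
      exact hR p
    refine ⟨?_, ciSup_le fun p => (hR p).2⟩
    exact (hR 0).1.trans (le_ciSup (f := fun p => ((Γ ∩ ball p R).ncard : ℝ) / (volume (ball p R)).toReal)
      ⟨a + ε / 3, by rintro _ ⟨p, rfl⟩; exact (hR p).2⟩ 0)
  have b1 : IsBoundedUnder (· ≤ ·) atTop (densR Γ) := ⟨a + ε / 3, by
    simpa using hd.mono fun R h => h.2⟩
  have b2 : IsBoundedUnder (· ≥ ·) atTop (densR Γ) := ⟨a - ε / 3, by
    simpa using hd.mono fun R h => h.1⟩
  have d1 : upDens Γ ≤ a + ε / 3 := limsup_le_of_le b2.isCoboundedUnder_le (hd.mono fun R h => h.2)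
  have d2 : a - ε / 3 ≤ upDens Γ := le_limsup_of_frequently_le (hd.mono fun R h => h.1).frequently b1
  filter_upwards [ha M hM] with R hR
  have := hR 0
  rw [Real.dist_eq, abs_lt]
  constructor <;> linarith [this.1, this.2]

noncomputable def fl {n : ℕ} (x : EuclideanSpace ℝ (Fin n)) : EuclideanSpace ℝ (Fin n) :=
  WithLp.toLp 2 (fun i => (⌊x i⌋ : ℝ))

abbrev cube (n : ℕ) : Set (EuclideanSpace ℝ (Fin n)) := {x | ∀ i, 0 ≤ x i ∧ x i < 1}

lemma cube_bdd {n : ℕ} {x : EuclideanSpace ℝ (Fin n)} (hx : x ∈ cube n) : ‖x‖ ≤ Real.sqrt n := by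
  rw [EuclideanSpace.norm_eq]
  apply Real.sqrt_le_sqrt
  calc ∑ i, ‖x i‖ ^ 2 ≤ ∑ i : Fin n, (1 : ℝ) := by
        refine Finset.sum_le_sum fun i _ => ?_
        have := hx i
        rw [Real.norm_eq_abs, sq_abs]
        nlinarith
    _ = n := by simp

lemma cube_eq (n : ℕ) : cube n = (WithLp.ofLp) ⁻¹' (Set.univ.pi fun _ : Fin n => Set.Ico (0 : ℝ) 1) := by
  ext x; simp

lemma cube_meas (n : ℕ) : MeasurableSet (cube n) := by
  rw [cube_eq]
  exact (PiLp.volume_preserving_ofLp (Fin n)).measurable (MeasurableSet.univ_pi fun _ => measurableSet_Ico)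

lemma cube_vol (n : ℕ) : volume (cube n) = 1 := by
  rw [cube_eq, (PiLp.volume_preserving_ofLp (Fin n)).measure_preimage
    (MeasurableSet.univ_pi fun _ => measurableSet_Ico).nullMeasurableSet, Real.volume_pi_Ico]
  simp

lemma sub_fl {n : ℕ} (x : EuclideanSpace ℝ (Fin n)) : x - fl x ∈ cube n := by
  intro i
  simp only [fl, PiLp.sub_apply]
  exact ⟨by linarith [Int.floor_le (x i)], by linarith [Int.lt_floor_add_one (x i)]⟩

lemma Zn_cube {n : ℕ} (x : EuclideanSpace ℝ (Fin n)) : Zn n ∩ {γ | x - γ ∈ cube n} = {fl x} := by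
  ext γ
  constructor
  · rintro ⟨h1, h2⟩
    rw [Set.mem_singleton_iff]
    ext i
    obtain ⟨m, hm⟩ := h1 i
    have := h2 i
    simp only [PiLp.sub_apply, hm] at this
    have h3 : ⌊x i⌋ = m := Int.floor_eq_iff.2 ⟨by linarith, by linarith⟩
    simp [fl, h3, hm]
  · rintro rfl
    exact ⟨fun i => ⟨⌊x i⌋, rfl⟩, sub_fl x⟩

lemma Zn_tendsto (n : ℕ) :
    Tendsto (fun R => ((Zn n ∩ ball 0 R).ncard : ℝ) / vB n R) atTop (nhds 1) := by
  rw [Metric.tendsto_nhds]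
  intro ε hε
  have h := step (n := n) (Γ := Zn n) le_rfl LinearMap.id (by simp) (cube_meas n) (r := Real.sqrt n + 1)
    (fun x hx => by simpa using lt_of_le_of_lt (cube_bdd hx) (lt_add_one _)) (by simp [cube_vol])
    (l := 1) (u := 1) (l' := 1 - ε / 2) (u' := 1 + ε / 2)
    (fun x => by rw [Zn_cube, cube_vol]; simp) (fun x => by rw [Zn_cube, cube_vol]; simp)
    (by linarith) (by linarith)
  filter_upwards [h] with R hR
  have := hR 0
  rw [LinearMap.id_coe, Set.preimage_id] at this
  rw [Real.dist_eq, abs_lt]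
  constructor <;> linarith [this.1, this.2]

noncomputable def lin {n : ℕ} (A : ℕ → (EuclideanSpace ℝ (Fin n) →ₗ[ℝ] EuclideanSpace ℝ (Fin n))) :
    ℕ → (EuclideanSpace ℝ (Fin n) →ₗ[ℝ] EuclideanSpace ℝ (Fin n))
  | 0 => LinearMap.id
  | (k + 1) => A k ∘ₗ lin A k

lemma det_lin {n : ℕ} (A : ℕ → (EuclideanSpace ℝ (Fin n) →ₗ[ℝ] EuclideanSpace ℝ (Fin n))) (k : ℕ) :
    LinearMap.det (lin A k) = ∏ i ∈ Finset.range k, LinearMap.det (A i) := by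
  induction k with
  | zero => simp [lin]
  | succ k ih => rw [lin, LinearMap.det_comp, ih, Finset.prod_range_succ, mul_comm]

theorem rate_of_injectivity_eq_density {n : ℕ}
    (π : EuclideanSpace ℝ (Fin n) → EuclideanSpace ℝ (Fin n))
    (hπ1 : ∀ x, ∀ i : Fin n, ∃ m : ℤ, π x i = (m : ℝ))
    (hπ2 : ∀ x y : EuclideanSpace ℝ (Fin n), (∀ i : Fin n, ∃ m : ℤ, y i = (m : ℝ)) →
      dist x (π x) ≤ dist x y)
    (A : ℕ → (EuclideanSpace ℝ (Fin n) →ₗ[ℝ] EuclideanSpace ℝ (Fin n)))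
    (hinv : ∀ i, LinearMap.det (A i) ≠ 0)
    (hdet : ∀ j : ℕ, |∏ i ∈ Finset.range j, LinearMap.det (A i)| = 1)
    (k : ℕ)
    (hwap : WAP (iterComp (fun i => π ∘ A i) k ''
      {x : EuclideanSpace ℝ (Fin n) | ∀ i : Fin n, ∃ m : ℤ, x i = (m : ℝ)})) :
    Tendsto (fun R : ℝ =>
        ((iterComp (fun i => π ∘ A i) k ''
            ({x : EuclideanSpace ℝ (Fin n) | ∀ i : Fin n, ∃ m : ℤ, x i = (m : ℝ)} ∩
              ball (0 : EuclideanSpace ℝ (Fin n)) R)).ncard : ℝ) /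
          (({x : EuclideanSpace ℝ (Fin n) | ∀ i : Fin n, ∃ m : ℤ, x i = (m : ℝ)} ∩
              ball (0 : EuclideanSpace ℝ (Fin n)) R).ncard : ℝ))
      atTop
      (nhds (upDens (iterComp (fun i => π ∘ A i) k ''
        {x : EuclideanSpace ℝ (Fin n) | ∀ i : Fin n, ∃ m : ℤ, x i = (m : ℝ)}))) := by
  set f := iterComp (fun i => π ∘ A i) k with hf
  change WAP (f '' Zn n) at hwap
  change Tendsto (fun R : ℝ => ((f '' (Zn n ∩ ball 0 R)).ncard : ℝ) / ((Zn n ∩ ball 0 R).ncard : ℝ))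
    atTop (nhds (upDens (f '' Zn n)))
  have hfZ : f '' Zn n ⊆ Zn n := by
    rintro _ ⟨x, hx, rfl⟩
    rw [hf]
    cases k with
    | zero => exact hx
    | succ k => exact hπ1 _
  -- bounded distance to the linear map
  have hC : ∀ j, ∃ C, 0 ≤ C ∧ ∀ x, ‖iterComp (fun i => π ∘ A i) j x - lin A j x‖ ≤ C := by
    intro j
    induction j with
    | zero => exact ⟨0, le_rfl, fun x => by simp [iterComp, lin]⟩
    | succ j ih =>
      obtain ⟨C, hC0, hC⟩ := ih
      let Ac := LinearMap.toContinuousLinearMap (A j)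
      refine ⟨Real.sqrt n + ‖Ac‖ * C, by positivity, fun x => ?_⟩
      set y := iterComp (fun i => π ∘ A i) j x
      have e : iterComp (fun i => π ∘ A i) (j + 1) x - lin A (j + 1) x
          = (π (A j y) - A j y) + A j (y - lin A j x) := by
        rw [map_sub]
        simp [iterComp, lin, y]
      rw [e]
      refine (norm_add_le _ _).trans (add_le_add ?_ ?_)
      · have h1 := hπ2 (A j y) (fl (A j y)) (fun i => ⟨⌊(A j y) i⌋, rfl⟩)
        rw [dist_eq_norm, dist_eq_norm] at h1
        rw [norm_sub_rev]
        exact h1.trans (cube_bdd (sub_fl _))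
      · exact (Ac.le_opNorm _).trans (mul_le_mul_of_nonneg_left (hC x) (norm_nonneg _))
  obtain ⟨C, hC0, hC⟩ := hC k
  rw [← hf] at hC
  have hL : |LinearMap.det (lin A k)| = 1 := by rw [det_lin]; exact hdet k
  have hL0 : LinearMap.det (lin A k) ≠ 0 := by intro h; simp [h] at hL
  let e := LinearMap.equivOfDetNeZero (lin A k) hL0
  let M : EuclideanSpace ℝ (Fin n) →ₗ[ℝ] EuclideanSpace ℝ (Fin n) := e.symm
  have hML : ∀ x, M (lin A k x) = x := fun x => e.symm_apply_apply x
  have hM : |LinearMap.det M| = 1 := by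
    have h1 : M ∘ₗ lin A k = LinearMap.id := LinearMap.ext hML
    have h2 := congrArg LinearMap.det h1
    rw [LinearMap.det_comp, LinearMap.det_id] at h2
    have h3 := congrArg abs h2
    rwa [abs_mul, hL, mul_one, abs_one] at h3
  let Mc := LinearMap.toContinuousLinearMap M
  set c := ‖Mc‖ * C
  have hc : ∀ x, ‖M (f x) - x‖ ≤ c := by
    intro x
    have : M (f x) - x = M (f x - lin A k x) := by rw [map_sub, hML]
    rw [this]
    exact (Mc.le_opNorm _).trans (mul_le_mul_of_nonneg_left (hC x) (norm_nonneg _))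
  set Γ := f '' Zn n with hΓ
  have up : ∀ R, f '' (Zn n ∩ ball 0 R) ⊆ Γ ∩ M ⁻¹' ball 0 (R + c) := by
    rintro R _ ⟨x, ⟨hx, hxR⟩, rfl⟩
    refine ⟨⟨x, hx, rfl⟩, ?_⟩
    have h1 := hc x
    simp only [Set.mem_preimage, mem_ball, dist_zero_right] at hxR ⊢
    have := norm_add_le (M (f x) - x) x
    rw [sub_add_cancel] at this
    linarith
  have lo : ∀ R, Γ ∩ M ⁻¹' ball 0 (R - c) ⊆ f '' (Zn n ∩ ball 0 R) := by
    rintro R _ ⟨⟨x, hx, rfl⟩, hxR⟩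
    refine ⟨x, ⟨hx, ?_⟩, rfl⟩
    have h1 := hc x
    simp only [Set.mem_preimage, mem_ball, dist_zero_right] at hxR ⊢
    have := norm_sub_le (M (f x)) (M (f x) - x)
    rw [sub_sub_cancel] at this
    linarith
  have lim := wap_tendsto hfZ hwap M hM
  have shift : ∀ d : ℝ, Tendsto (fun R => ((Γ ∩ M ⁻¹' ball 0 (R + d)).ncard : ℝ) / vB n R) atTop
      (nhds (upDens Γ)) := by
    intro d
    have h1 := (lim.comp (tendsto_atTop_add_const_right atTop d tendsto_id)).mul (vB_ratio (n := n) d)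
    rw [mul_one] at h1
    refine h1.congr' ?_
    filter_upwards [eventually_gt_atTop (-d)] with R hR
    have := vB_pos (n := n) (by linarith : 0 < R + d)
    simp only [Function.comp, id]
    rw [div_mul_div_cancel₀ this.ne']
  have mid : Tendsto (fun R => ((f '' (Zn n ∩ ball 0 R)).ncard : ℝ) / vB n R) atTop
      (nhds (upDens Γ)) := by
    refine tendsto_of_tendsto_of_tendsto_of_le_of_le (shift (-c)) (shift c) ?_ ?_
    · intro R
      refine div_le_div_of_nonneg_right (Nat.cast_le.2 (Set.ncard_le_ncard ?_ ?_)) ENNReal.toReal_nonneg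
      · exact lo R
      · exact (Zn_finite 0 R).image f
    · intro R
      refine div_le_div_of_nonneg_right (Nat.cast_le.2 (Set.ncard_le_ncard (up R) ?_)) ENNReal.toReal_nonneg
      exact finM hfZ M hM _ _
  have fin := mid.div (Zn_tendsto n) one_ne_zero
  rw [div_one] at fin
  refine fin.congr' ?_
  filter_upwards [eventually_gt_atTop 0] with R hR
  exact div_div_div_cancel_right₀ (vB_pos hR).ne' _ _
end
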